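/- Let K be an algebraically closed field (of any characteristic) and n ≥ 3. The total Betti numbers of the coordinate ring O_{1,2,n} of the Kalman variety K_{1,2,n} over the polynomial ring A are: dim_K Tor_0^A(O_{1,2,n}, 𝕜) = 1; dim_K Tor_i^A(O_{1,2,n}, 𝕜) = C(2n−4, i+1) − 2·C(n−2, i+1) for 1 ≤ i ≤ n−3; dim_K Tor_i^A(O_{1,2,n}, 𝕜) = C(2n−4, i+1) for n−2 ≤ i ≤ 2n−5; and Tor_i^A(O_{1,2,n}, 𝕜) = 0 for i > 2n−5. Here 𝕜 = A/A₊ is the residue field at the irrelevant maximal ideal and C(a,b) denotes the binomial coefficient. -/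

import Mathlib

set_option synthInstance.maxHeartbeats 1000000
set_option maxHeartbeats 4000000

open Matrix

/-- The span of the first `d` standard basis vectors of `K^n`. -/
def firstCoordsSubspace (K : Type*) [Field K] (n d : ℕ) : Submodule K (Fin n → K) where
  carrier := {v | ∀ i : Fin n, d ≤ (i : ℕ) → v i = 0}
  add_mem' := fun hv hw i hi => by simp [hv i hi, hw i hi]
  zero_mem' := fun i _ => rfl
  smul_mem' := fun c v hv i hi => by simp [hv i hi]

/-- The Kalman variety `K_{s,d,n}`: matrices having an `s`-dimensional invariant
subspace contained in the span `L` of the first `d` standard basis vectors. -/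
def kalmanSet (K : Type*) [Field K] (n d s : ℕ) : Set (Matrix (Fin n) (Fin n) K) :=
  {M | ∃ U : Submodule K (Fin n → K), U ≤ firstCoordsSubspace K n d ∧
    Module.finrank K U = s ∧ ∀ v ∈ U, M.mulVec v ∈ U}

/-- The upper-left `d × d` block `α` of an `n × n` matrix. -/
def alphaBlock {K : Type*} [Field K] {n : ℕ} (d : ℕ) (h : d ≤ n)
    (M : Matrix (Fin n) (Fin n) K) : Matrix (Fin d) (Fin d) K :=
  fun i j => M (Fin.castLE h i) (Fin.castLE h j)

/-- The lower-left `(n-d) × d` block `γ` of an `n × n` matrix. -/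
def gammaBlock {K : Type*} [Field K] {n : ℕ} (d : ℕ) (h : d ≤ n)
    (M : Matrix (Fin n) (Fin n) K) : Matrix (Fin (n - d)) (Fin d) K :=
  fun i j => M ⟨d + (i : ℕ), by have := i.isLt; omega⟩ (Fin.castLE h j)

/-- The reduced Kalman matrix: the `d(n-d) × d` matrix obtained by stacking
`γ, γα, γα², …, γα^{d-1}`; row `(k, i)` is row `i` of the block `γ * α^k`. -/
def redKalman {K : Type*} [Field K] {n : ℕ} (d : ℕ) (h : d ≤ n)
    (M : Matrix (Fin n) (Fin n) K) : Matrix (Fin d × Fin (n - d)) (Fin d) K :=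
  fun p j => (gammaBlock d h M * (alphaBlock d h M) ^ (p.1 : ℕ)) p.2 j

/-- The vanishing ideal of a set of `n × n` matrices, inside the polynomial
coordinate ring `A = K[x_{ij}]` of the matrix space. -/
def matVanishingIdeal (K : Type*) [Field K] (n : ℕ)
    (S : Set (Matrix (Fin n) (Fin n) K)) : Ideal (MvPolynomial (Fin n × Fin n) K) where
  carrier := {f | ∀ M ∈ S, MvPolynomial.eval (fun p => M p.1 p.2) f = 0}
  add_mem' := fun ha hb M hM => by simp [ha M hM, hb M hM]
  zero_mem' := fun M hM => by simp
  smul_mem' := fun c f hf M hM => by simp [smul_eq_mul, hf M hM]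

/-- The coordinate ring `A` of the space of `n × n` matrices. -/
abbrev MatCoordRing (K : Type*) [Field K] (n : ℕ) := MvPolynomial (Fin n × Fin n) K

/-- The vanishing ideal `I_{s,d,n}` of the Kalman variety. -/
noncomputable def kalmanIdeal (K : Type*) [Field K] (n d s : ℕ) :
    Ideal (MatCoordRing K n) :=
  matVanishingIdeal K n (kalmanSet K n d s)

/-- The irrelevant (maximal graded) ideal `A₊` of the polynomial ring,
generated by all the variables. -/
noncomputable def irrelevantIdeal (K : Type*) [Field K] (n : ℕ) :
    Ideal (MatCoordRing K n) :=
  Ideal.span (Set.range MvPolynomial.X)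

/-- The coordinate ring `O_{s,d,n} = A/I_{s,d,n}` of the Kalman variety. -/
abbrev KalmanCoordRing (K : Type*) [Field K] (n d s : ℕ) :=
  MatCoordRing K n ⧸ kalmanIdeal K n d s


open CategoryTheory in
/-- The `A`-module `Tor_i^A(O_{s,d,n}, A/A₊)`. -/
noncomputable def kalmanTorModule (K : Type u) [Field K] (n d s i : ℕ) :
    ModuleCat.{u} (MatCoordRing K n) :=
  ((Tor (ModuleCat.{u} (MatCoordRing K n)) i).obj
      (ModuleCat.of (MatCoordRing K n) (KalmanCoordRing K n d s))).obj
    (ModuleCat.of (MatCoordRing K n) (MatCoordRing K n ⧸ irrelevantIdeal K n))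

/-- The `i`-th total Betti number `dim_K Tor_i^A(O_{s,d,n}, 𝕜)`, where
`𝕜 = A/A₊` is the residue field at the irrelevant maximal ideal. -/
noncomputable def kalmanBetti (K : Type u) [Field K] (n d s i : ℕ) : ℕ :=
  letI : Module K ↥(kalmanTorModule K n d s i) :=
    Module.compHom ↥(kalmanTorModule K n d s i) (algebraMap K (MatCoordRing K n))
  Module.finrank K ↥(kalmanTorModule K n d s i)

section TensorTor

open CategoryTheory MonoidalCategory

section TorTheory

variable {R : Type u} [CommRing R] (P : ChainComplex (ModuleCat.{u} R) ℕ)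

/-- The functor `X ↦ X ⊗ P`, for a fixed complex `P`. -/
noncomputable def tensorComplex : ModuleCat.{u} R ⥤ ChainComplex (ModuleCat.{u} R) ℕ where
  obj X := (((tensoringLeft (ModuleCat.{u} R)).obj X).mapHomologicalComplex _).obj P
  map f := (NatTrans.mapHomologicalComplex ((tensoringLeft (ModuleCat.{u} R)).map f) _).app P
  map_id X := by ext; simp
  map_comp f g := by ext; simp

/-- The homology modules `H_i(X ⊗ P)`. -/
noncomputable abbrev tHom (i : ℕ) (X : Type u) [AddCommGroup X] [Module R X] : ModuleCat.{u} R :=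
  ((tensorComplex P).obj (ModuleCat.of R X)).homology i

variable {X Y Z X' Y' Z' : Type u} [AddCommGroup X] [Module R X] [AddCommGroup Y] [Module R Y]
  [AddCommGroup X'] [Module R X'] [AddCommGroup Y'] [Module R Y'] [AddCommGroup Z'] [Module R Z']
  [AddCommGroup Z] [Module R Z]

/-- The map induced on `H_i(- ⊗ P)`. -/
noncomputable def tMap (i : ℕ) (f : X →ₗ[R] Y) : tHom P i X →ₗ[R] tHom P i Y :=
  (HomologicalComplex.homologyMap ((tensorComplex P).map (ModuleCat.ofHom f)) i).hom

lemma tMap_id (i : ℕ) : tMap P i (LinearMap.id : X →ₗ[R] X) = LinearMap.id := by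
  simp only [tMap, ModuleCat.ofHom_id, CategoryTheory.Functor.map_id,
    HomologicalComplex.homologyMap_id, ModuleCat.hom_id]

lemma tMap_comp (i : ℕ) (g : Y →ₗ[R] Z) (f : X →ₗ[R] Y) :
    tMap P i (g ∘ₗ f) = tMap P i g ∘ₗ tMap P i f := by
  simp only [tMap, ModuleCat.ofHom_comp, CategoryTheory.Functor.map_comp,
    HomologicalComplex.homologyMap_comp, ModuleCat.hom_comp]

lemma tMap_tMap (i : ℕ) (g : Y →ₗ[R] Z) (f : X →ₗ[R] Y) (t : tHom P i X) :
    tMap P i g (tMap P i f t) = tMap P i (g ∘ₗ f) t := by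
  rw [tMap_comp]; rfl

/-- The short complex of complexes attached to an exact sequence of modules. -/
noncomputable def tensorShort (f : X →ₗ[R] Y) (g : Y →ₗ[R] Z) (hfg : Function.Exact f g) :
    ShortComplex (ChainComplex (ModuleCat.{u} R) ℕ) :=
  ShortComplex.mk ((tensorComplex P).map (ModuleCat.ofHom f))
    ((tensorComplex P).map (ModuleCat.ofHom g)) (by
      rw [← Functor.map_comp, ← ModuleCat.ofHom_comp, hfg.linearMap_comp_eq_zero]
      ext i : 1
      refine ModuleCat.hom_ext ?_
      apply TensorProduct.ext'
      intro x y
      exact TensorProduct.zero_tmul _ _)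

lemma tensorShort_shortExact [∀ i, Projective (P.X i)] {f : X →ₗ[R] Y} {g : Y →ₗ[R] Z}
    (hf : Function.Injective f) (hfg : Function.Exact f g) (hg : Function.Surjective g) :
    (tensorShort P f g hfg).ShortExact := by
  apply HomologicalComplex.shortExact_of_degreewise_shortExact
  intro i
  have : Module.Projective R (P.X i) := (IsProjective.iff_projective _).2 inferInstance
  refine ModuleCat.shortComplex_shortExact _ ?_ ?_ ?_
  · exact rTensor_exact (P.X i) hfg hg
  · exact Module.Flat.rTensor_preserves_injective_linearMap (M := P.X i) f hf
  · exact LinearMap.rTensor_surjective (P.X i) hg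

/-- The connecting homomorphism. -/
noncomputable def tDelta [∀ i, Projective (P.X i)] {f : X →ₗ[R] Y} {g : Y →ₗ[R] Z}
    (hf : Function.Injective f) (hfg : Function.Exact f g) (hg : Function.Surjective g) (i : ℕ) :
    tHom P (i + 1) Z →ₗ[R] tHom P i X :=
  ((tensorShort_shortExact P hf hfg hg).δ (i + 1) i rfl).hom

section LES
variable [∀ i, Projective (P.X i)] {f : X →ₗ[R] Y} {g : Y →ₗ[R] Z}
    (hf : Function.Injective f) (hfg : Function.Exact f g) (hg : Function.Surjective g)
include hf hfg hg

lemma tMap_exact (i : ℕ) : Function.Exact (tMap P i f) (tMap P i g) :=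
  (ShortComplex.ShortExact.moduleCat_exact_iff_function_exact _).1
    ((tensorShort_shortExact P hf hfg hg).homology_exact₂ i)

lemma tMap_tDelta_exact (i : ℕ) :
    Function.Exact (tMap P (i + 1) g) (tDelta P hf hfg hg i) :=
  (ShortComplex.ShortExact.moduleCat_exact_iff_function_exact _).1
    ((tensorShort_shortExact P hf hfg hg).homology_exact₃ (i + 1) i rfl)

lemma tDelta_tMap_exact (i : ℕ) :
    Function.Exact (tDelta P hf hfg hg i) (tMap P i f) :=
  (ShortComplex.ShortExact.moduleCat_exact_iff_function_exact _).1
    ((tensorShort_shortExact P hf hfg hg).homology_exact₁ (i + 1) i rfl)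

omit [∀ i, Projective (P.X i)] hf hfg in
lemma tMap_zero_surjective : Function.Surjective (tMap P 0 g) := by
  have : Epi (((tensorComplex P).map (ModuleCat.ofHom g)).f 0) :=
    (ModuleCat.epi_iff_surjective _).2 (LinearMap.rTensor_surjective (P.X 0) hg)
  have := HomologicalComplex.epi_homologyMap_of_epi_of_not_rel
    ((tensorComplex P).map (ModuleCat.ofHom g)) 0 (by simp)
  exact (ModuleCat.epi_iff_surjective _).1 this

omit hf hfg hg in
lemma tDelta_naturality {f' : X' →ₗ[R] Y'} {g' : Y' →ₗ[R] Z'}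
    (hf : Function.Injective f) (hfg : Function.Exact f g) (hg : Function.Surjective g)
    (hf' : Function.Injective f') (hfg' : Function.Exact f' g') (hg' : Function.Surjective g')
    (φ : X →ₗ[R] X') (ψ : Y →ₗ[R] Y') (χ : Z →ₗ[R] Z')
    (h₁ : ψ ∘ₗ f = f' ∘ₗ φ) (h₂ : χ ∘ₗ g = g' ∘ₗ ψ) (i : ℕ) (t : tHom P (i + 1) Z) :
    tDelta P hf' hfg' hg' i (tMap P (i + 1) χ t) = tMap P i φ (tDelta P hf hfg hg i t) := by
  let Φ : tensorShort P f g hfg ⟶ tensorShort P f' g' hfg' :=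
    { τ₁ := (tensorComplex P).map (ModuleCat.ofHom φ)
      τ₂ := (tensorComplex P).map (ModuleCat.ofHom ψ)
      τ₃ := (tensorComplex P).map (ModuleCat.ofHom χ)
      comm₁₂ := by
        simp only [tensorShort, ← Functor.map_comp, ← ModuleCat.ofHom_comp, h₁]
      comm₂₃ := by
        simp only [tensorShort, ← Functor.map_comp, ← ModuleCat.ofHom_comp, h₂] }
  have := HomologicalComplex.HomologySequence.δ_naturality Φ
    (tensorShort_shortExact P hf hfg hg) (tensorShort_shortExact P hf' hfg' hg') (i + 1) i rfl
  exact (congrArg (fun m => m.hom t) this).symm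
end LES

lemma tMap_smul_eq_zero {k : ModuleCat.{u} R} (Q : ProjectiveResolution k) (a : R)
    (ha : ∀ x : k, a • x = 0) (i : ℕ) :
    tMap Q.complex i (a • (LinearMap.id : X →ₗ[R] X)) = 0 := by
  have h0 : (a • 𝟙 Q.complex) ≫ Q.π = 0 := by
    ext : 1
    refine ModuleCat.hom_ext (LinearMap.ext fun x => ?_)
    exact (map_smul (Q.π.f 0).hom a x).trans (ha _)
  have h1 := ((tensoringLeft (ModuleCat.{u} R)).obj (ModuleCat.of R X)).mapHomotopy
    (ProjectiveResolution.liftHomotopyZero _ h0)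
  have h2 := h1.homologyMap_eq i
  rw [Functor.map_zero, HomologicalComplex.homologyMap_zero] at h2
  have h3 : (tensorComplex Q.complex).map (ModuleCat.ofHom (a • (LinearMap.id : X →ₗ[R] X))) =
      (((tensoringLeft (ModuleCat.{u} R)).obj (ModuleCat.of R X)).mapHomologicalComplex _).map
        (a • 𝟙 Q.complex) := by
    ext i : 1
    refine ModuleCat.hom_ext ?_
    apply TensorProduct.ext'
    intro x y
    exact TensorProduct.smul_tmul a x y
  refine (congrArg (fun m => ModuleCat.Hom.hom (HomologicalComplex.homologyMap m i)) h3).trans ?_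
  exact congrArg ModuleCat.Hom.hom h2

/-- `R ⊗ P` is isomorphic to `P`. -/
noncomputable def tensorComplexSelfIso : (tensorComplex P).obj (ModuleCat.of R R) ≅ P :=
  HomologicalComplex.Hom.isoOfComponents (fun i => λ_ (P.X i))
    (fun i j _ => (leftUnitor_naturality (P.d i j)).symm)

lemma subsingleton_tHom_self {k : ModuleCat.{u} R} (Q : ProjectiveResolution k) (i : ℕ) :
    Subsingleton (tHom Q.complex (i + 1) R) := by
  have h : Limits.IsZero (tHom Q.complex (i + 1) R) :=
    ((Q.complex_exactAt_succ i).isZero_homology).of_iso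
      ((HomologicalComplex.homologyFunctor _ _ (i + 1)).mapIso (tensorComplexSelfIso Q.complex))
  exact ModuleCat.subsingleton_of_isZero h

lemma nonempty_tHom_self_equiv {k : ModuleCat.{u} R} (Q : ProjectiveResolution k) :
    Nonempty (tHom Q.complex 0 R ≃ₗ[R] k) := by
  have e : tHom Q.complex 0 R ≅ k :=
    (HomologicalComplex.homologyFunctor _ _ 0).mapIso (tensorComplexSelfIso Q.complex) ≪≫
      isoOfQuasiIsoAt Q.π 0 ≪≫ HomologicalComplex.singleObjHomologySelfIso _ _ _
  exact ⟨e.toLinearEquiv⟩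

lemma nonempty_tor_equiv {k : ModuleCat.{u} R} (Q : ProjectiveResolution k) (i : ℕ) :
    Nonempty (((Tor (ModuleCat.{u} R) i).obj (ModuleCat.of R X)).obj k ≃ₗ[R]
      tHom Q.complex i X) :=
  ⟨(Q.isoLeftDerivedObj ((tensoringLeft (ModuleCat.{u} R)).obj (ModuleCat.of R X)) i).toLinearEquiv⟩

end TorTheory

section SMul

variable {R : Type u} [CommRing R] (P : ChainComplex (ModuleCat.{u} R) ℕ)
variable {X : Type u} [AddCommGroup X] [Module R X]

lemma homologyMap_smul_id {C : ChainComplex (ModuleCat.{u} R) ℕ} (a : R) (i : ℕ) :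
    HomologicalComplex.homologyMap (a • 𝟙 C) i = a • 𝟙 (C.homology i) := by
  have h : (HomologicalComplex.shortComplexFunctor (ModuleCat.{u} R) (ComplexShape.down ℕ) i).map
      (a • 𝟙 C) = a • 𝟙 (C.sc i) := by
    ext : 1 <;> rfl
  rw [HomologicalComplex.homologyMap, h, ShortComplex.homologyMap_smul,
    ShortComplex.homologyMap_id]
  rfl

lemma tMap_smul_id (a : R) (i : ℕ) :
    tMap P i (a • (LinearMap.id : X →ₗ[R] X)) = a • LinearMap.id := by
  have h : (tensorComplex P).map (ModuleCat.ofHom (a • (LinearMap.id : X →ₗ[R] X))) =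
      a • 𝟙 ((tensorComplex P).obj (ModuleCat.of R X)) := by
    ext i : 1
    have h1 : ModuleCat.ofHom (a • (LinearMap.id : X →ₗ[R] X)) = a • 𝟙 _ := rfl
    rw [HomologicalComplex.smul_f_apply, HomologicalComplex.id_f, h1]
    exact (MonoidalLinear.smul_whiskerRight a (𝟙 (ModuleCat.of R X)) (P.X i)).trans
      (congrArg (a • ·) (id_whiskerRight _ _))
  rw [tMap, h, homologyMap_smul_id, ModuleCat.hom_smul, ModuleCat.hom_id]

lemma smul_tor_eq_zero {k : ModuleCat.{u} R} (a : R) (ha : ∀ x : k, a • x = 0) (i : ℕ)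
    (w : ((Tor (ModuleCat.{u} R) i).obj (ModuleCat.of R X)).obj k) : a • w = 0 := by
  let Q := projectiveResolution k
  obtain ⟨E⟩ := nonempty_tor_equiv (X := X) Q i
  have h1 := LinearMap.congr_fun (tMap_smul_eq_zero (X := X) Q a ha i) (E w)
  rw [tMap_smul_id, LinearMap.smul_apply, LinearMap.id_apply, LinearMap.zero_apply,
    ← map_smul] at h1
  exact (LinearEquiv.map_eq_zero_iff E).1 h1

end SMul

end TensorTor

section BettiComputation

open CategoryTheory

section ExactTor

/-- A short exact sequence of modules. -/
structure Ses (R : Type u) [CommRing R] (X Y Z : Type u) [AddCommGroup X] [Module R X]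
    [AddCommGroup Y] [Module R Y] [AddCommGroup Z] [Module R Z] where
  /-- the injection -/
  f : X →ₗ[R] Y
  /-- the projection -/
  g : Y →ₗ[R] Z
  inj : Function.Injective f
  exact : Function.Exact f g
  surj : Function.Surjective g

variable {R : Type u} [CommRing R] (P : ChainComplex (ModuleCat.{u} R) ℕ)
variable {X Y Z X' Y' Z' : Type u} [AddCommGroup X] [Module R X] [AddCommGroup Y] [Module R Y]
  [AddCommGroup X'] [Module R X'] [AddCommGroup Y'] [Module R Y'] [AddCommGroup Z'] [Module R Z']
  [AddCommGroup Z] [Module R Z]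

/-- The map induces zero on all homology modules `H_i(- ⊗ P)`. -/
def TZero (f : X →ₗ[R] Y) : Prop := ∀ i, tMap P i f = 0

/-- The map induces an injection on all homology modules `H_i(- ⊗ P)`. -/
def TInj (f : X →ₗ[R] Y) : Prop := ∀ i, Function.Injective (tMap P i f)

/-- Multiplication by elements of `m` induces zero on `H_i(- ⊗ P)`. -/
def Kills (m : Ideal R) : Prop :=
  ∀ (X : Type u) [AddCommGroup X] [Module R X], ∀ a ∈ m, TZero P (a • (LinearMap.id : X →ₗ[R] X))

/-- The length of `H_i(X ⊗ P)`. -/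
noncomputable def tLen (i : ℕ) (X : Type u) [AddCommGroup X] [Module R X] : ℕ∞ :=
  Module.length R (tHom P i X)

variable {P}

lemma TZero.comp_right {g : Y →ₗ[R] Z} (hg : TZero P g) (f : X →ₗ[R] Y) : TZero P (g ∘ₗ f) := by
  intro i; rw [tMap_comp, hg i, LinearMap.zero_comp]

lemma Kills.smul {m : Ideal R} (hm : Kills P m) {a : R} (ha : a ∈ m) (f : X →ₗ[R] Y) :
    TZero P (a • f) := by
  have := (hm Y a ha).comp_right f
  rwa [LinearMap.smul_comp, LinearMap.id_comp] at this

lemma TInj.comp {g : Y →ₗ[R] Z} {f : X →ₗ[R] Y} (hg : TInj P g) (hf : TInj P f) :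
    TInj P (g ∘ₗ f) := by
  intro i; rw [tMap_comp, LinearMap.coe_comp]; exact (hg i).comp (hf i)

lemma tInj_id : TInj P (LinearMap.id : X →ₗ[R] X) := by
  intro i; rw [tMap_id]; exact Function.injective_id

lemma tLen_congr (e : X ≃ₗ[R] Y) (i : ℕ) : tLen P i X = tLen P i Y := by
  refine LinearEquiv.length_eq (LinearEquiv.ofLinearMap (tMap P i e.toLinearMap)
    (tMap P i e.symm.toLinearMap) ?_ ?_)
  · rw [← tMap_comp]; simp [tMap_id]
  · rw [← tMap_comp]; simp [tMap_id]

lemma LinearMap.length_eq_ker_add_range {M N : Type*} [AddCommGroup M] [Module R M]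
    [AddCommGroup N] [Module R N] (f : M →ₗ[R] N) :
    Module.length R M = Module.length R (LinearMap.ker f) + Module.length R (LinearMap.range f) :=
  Module.length_eq_add_of_exact (LinearMap.ker f).subtype f.rangeRestrict
    (Submodule.injective_subtype _) f.surjective_rangeRestrict
    (by rw [LinearMap.exact_iff, LinearMap.ker_rangeRestrict, Submodule.range_subtype])

/-- Lengths in a five-term exact sequence. -/
lemma length_five {A B C D E : Type*} [AddCommGroup A] [Module R A] [AddCommGroup B] [Module R B]
    [AddCommGroup C] [Module R C] [AddCommGroup D] [Module R D] [AddCommGroup E] [Module R E]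
    (a : A →ₗ[R] B) (b : B →ₗ[R] C) (c : C →ₗ[R] D) (d : D →ₗ[R] E)
    (hab : Function.Exact a b) (hbc : Function.Exact b c) (hcd : Function.Exact c d) :
    Module.length R C + Module.length R (LinearMap.range a) + Module.length R (LinearMap.range d) =
      Module.length R B + Module.length R D := by
  have h1 := LinearMap.length_eq_ker_add_range b
  have h2 := LinearMap.length_eq_ker_add_range c
  have h3 := LinearMap.length_eq_ker_add_range d
  rw [LinearMap.exact_iff.1 hab] at h1
  rw [LinearMap.exact_iff.1 hbc] at h2
  rw [LinearMap.exact_iff.1 hcd] at h3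
  rw [h1, h2, h3]; ring

lemma length_range_of_injective {M N : Type*} [AddCommGroup M] [Module R M]
    [AddCommGroup N] [Module R N] (f : M →ₗ[R] N) (hf : Function.Injective f) :
    Module.length R (LinearMap.range f) = Module.length R M :=
  ((LinearEquiv.ofInjective f hf).length_eq).symm

variable [∀ i, Projective (P.X i)]

namespace Ses

variable (s : Ses R X Y Z)

variable (P) in
/-- The connecting homomorphism of a short exact sequence. -/
noncomputable def delta (i : ℕ) : tHom P (i + 1) Z →ₗ[R] tHom P i X :=
  tDelta P s.inj s.exact s.surj i

lemma exact_mid (i : ℕ) : Function.Exact (tMap P i s.f) (tMap P i s.g) :=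
  tMap_exact P s.inj s.exact s.surj i

lemma exact_right (i : ℕ) : Function.Exact (tMap P (i + 1) s.g) (s.delta P i) :=
  tMap_tDelta_exact P s.inj s.exact s.surj i

lemma exact_left (i : ℕ) : Function.Exact (s.delta P i) (tMap P i s.f) :=
  tDelta_tMap_exact P s.inj s.exact s.surj i

lemma delta_naturality (s' : Ses R X' Y' Z') (φ : X →ₗ[R] X') (ψ : Y →ₗ[R] Y') (χ : Z →ₗ[R] Z')
    (h₁ : ψ ∘ₗ s.f = s'.f ∘ₗ φ) (h₂ : χ ∘ₗ s.g = s'.g ∘ₗ ψ) (i : ℕ) (t : tHom P (i + 1) Z) :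
    s'.delta P i (tMap P (i + 1) χ t) = tMap P i φ (s.delta P i t) :=
  tDelta_naturality P s.inj s.exact s.surj s'.inj s'.exact s'.surj φ ψ χ h₁ h₂ i t

variable {s}

lemma tInj_of_tZero (h : TZero P s.f) : TInj P s.g := by
  intro i
  rw [← LinearMap.ker_eq_bot, LinearMap.exact_iff.1 (s.exact_mid i), h i, LinearMap.range_zero]

lemma tZero_of_tInj (h : TInj P s.g) : TZero P s.f := by
  intro i
  ext t
  exact h i (((s.exact_mid i).apply_apply_eq_zero t).trans (map_zero _).symm)

lemma delta_surjective (h : TZero P s.f) (i : ℕ) : Function.Surjective (s.delta P i) := by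
  rw [← LinearMap.range_eq_top, ← LinearMap.exact_iff.1 (s.exact_left i), h i, LinearMap.ker_zero]

lemma tLen_zero (h : TZero P s.f) : tLen P 0 Z = tLen P 0 Y :=
  ((LinearEquiv.ofBijective (tMap P 0 s.g)
    ⟨tInj_of_tZero h 0, tMap_zero_surjective P s.surj⟩).length_eq).symm

lemma tLen_succ (h : TZero P s.f) (i : ℕ) :
    tLen P (i + 1) Z = tLen P (i + 1) Y + tLen P i X :=
  Module.length_eq_add_of_exact _ _ (tInj_of_tZero h (i + 1)) (delta_surjective h i)
    (s.exact_right i)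

lemma tLen_range_succ (i : ℕ) :
    tLen P (i + 1) Y + Module.length R (LinearMap.range (s.delta P (i + 1))) +
      Module.length R (LinearMap.range (s.delta P i)) = tLen P (i + 1) X + tLen P (i + 1) Z :=
  length_five _ _ _ _ (s.exact_left (i + 1)) (s.exact_mid (i + 1)) (s.exact_right i)

lemma tLen_range_zero :
    tLen P 0 Y + Module.length R (LinearMap.range (s.delta P 0)) = tLen P 0 X + tLen P 0 Z := by
  have := length_five (R := R) _ _ _ (0 : tHom P 0 Z →ₗ[R] tHom P 0 Z)
    (s.exact_left (P := P) 0) (s.exact_mid 0) (by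
    rw [LinearMap.exact_iff, LinearMap.ker_zero, LinearMap.range_eq_top.2
      (tMap_zero_surjective P s.surj)])
  rw [LinearMap.range_zero] at this
  simpa [tLen] using this

end Ses
end ExactTor

section Quotients

variable {R : Type u} [CommRing R]

/-- Multiplication by `f`, as a map `R/H → R/I`. -/
def mulQ (f : R) {H I : Ideal R} (h : ∀ g ∈ H, f * g ∈ I) : (R ⧸ H) →ₗ[R] (R ⧸ I) :=
  Submodule.mapQ H I (LinearMap.mulLeft R f) h

lemma mulQ_mk (f : R) {H I : Ideal R} (h : ∀ g ∈ H, f * g ∈ I) (g : R) :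
    mulQ f h (Submodule.Quotient.mk g) = Submodule.Quotient.mk (f * g) := rfl

lemma factor_quot_mk {I J : Ideal R} (h : I ≤ J) (g : R) :
    Submodule.factor h (Submodule.Quotient.mk g) = Submodule.Quotient.mk g := rfl

lemma quot_hom_ext {I : Ideal R} {M : Type*} [AddCommGroup M] [Module R M]
    {φ ψ : (R ⧸ I) →ₗ[R] M}
    (h : ∀ g : R, φ (Submodule.Quotient.mk g) = ψ (Submodule.Quotient.mk g)) : φ = ψ := by
  ext
  exact h 1

lemma tMap_factor_factor (P : ChainComplex (ModuleCat.{u} R) ℕ) (i : ℕ) {I J L : Ideal R}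
    (h₁ : I ≤ J) (h₂ : J ≤ L) (h : I ≤ L) (t : tHom P i (R ⧸ I)) :
    tMap P i (Submodule.factor h₂) (tMap P i (Submodule.factor h₁) t) =
      tMap P i (Submodule.factor h) t := by
  rw [tMap_tMap]
  congr 2
  exact quot_hom_ext fun g => rfl

lemma range_tMap_factor_congr (P : ChainComplex (ModuleCat.{u} R) ℕ) (i : ℕ) {I I' J : Ideal R}
    (e : I = I') (h : I ≤ J) (h' : I' ≤ J) :
    LinearMap.range (tMap P i (Submodule.factor h)) =
      LinearMap.range (tMap P i (Submodule.factor h')) := by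
  subst e; rfl

/-- The sequence `0 → R/H → R/I → R/U → 0` given by multiplication by `f`. -/
def colonSes (f : R) (H I U : Ideal R) (h : ∀ g, f * g ∈ I ↔ g ∈ H)
    (hU : U = I ⊔ Ideal.span {f}) : Ses R (R ⧸ H) (R ⧸ I) (R ⧸ U) where
  f := mulQ f fun g hg => (h g).2 hg
  g := Submodule.factor (hU ▸ le_sup_left)
  inj := by
    rw [← LinearMap.ker_eq_bot, LinearMap.ker_eq_bot']
    intro t
    obtain ⟨g, rfl⟩ := Submodule.Quotient.mk_surjective _ t
    intro hg
    rw [mulQ_mk, Submodule.Quotient.mk_eq_zero] at hg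
    exact (Submodule.Quotient.mk_eq_zero _).2 ((h g).1 hg)
  exact := by
    intro t
    obtain ⟨g, rfl⟩ := Submodule.Quotient.mk_surjective _ t
    rw [factor_quot_mk, Submodule.Quotient.mk_eq_zero, hU, Submodule.mem_sup]
    constructor
    · rintro ⟨a, ha, b, hb, rfl⟩
      obtain ⟨z, rfl⟩ := Ideal.mem_span_singleton'.1 hb
      refine ⟨Submodule.Quotient.mk z, ?_⟩
      rw [mulQ_mk, Submodule.Quotient.eq]
      simpa [mul_comm] using ha
    · rintro ⟨s, hs⟩
      obtain ⟨a, rfl⟩ := Submodule.Quotient.mk_surjective _ s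
      rw [mulQ_mk, Submodule.Quotient.eq] at hs
      exact ⟨g - f * a, by simpa using I.neg_mem hs, f * a,
        Ideal.mul_mem_right _ _ (Ideal.mem_span_singleton_self f), by ring⟩
  surj := Submodule.factor_surjective _

section ColonDelta

variable (P : ChainComplex (ModuleCat.{u} R) ℕ) [∀ i, Projective (P.X i)]

/-- The connecting homomorphism of `colonSes`. -/
noncomputable def colonDelta (i : ℕ) {f : R} {H I U : Ideal R} (h : ∀ g, f * g ∈ I ↔ g ∈ H)
    (hU : U = I ⊔ Ideal.span {f}) : tHom P (i + 1) (R ⧸ U) →ₗ[R] tHom P i (R ⧸ H) :=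
  (colonSes f H I U h hU).delta P i

lemma colonDelta_eq_zero_iff (i : ℕ) {f : R} {H I U : Ideal R} (h : ∀ g, f * g ∈ I ↔ g ∈ H)
    (hU : U = I ⊔ Ideal.span {f}) (hIU : I ≤ U) (t : tHom P (i + 1) (R ⧸ U)) :
    colonDelta P i h hU t = 0 ↔ t ∈ LinearMap.range (tMap P (i + 1) (Submodule.factor hIU)) :=
  (colonSes f H I U h hU).exact_right i t

lemma colonDelta_surjective (i : ℕ) {f : R} {H I U : Ideal R} (h : ∀ g, f * g ∈ I ↔ g ∈ H)
    (hU : U = I ⊔ Ideal.span {f}) (hz : TZero P (mulQ f fun g hg => (h g).2 hg)) :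
    Function.Surjective (colonDelta P i h hU) :=
  Ses.delta_surjective (s := colonSes f H I U h hU) hz i

lemma colonDelta_naturality (i : ℕ) {f f' : R} {H I U H' I' U' : Ideal R}
    (h : ∀ g, f * g ∈ I ↔ g ∈ H) (hU : U = I ⊔ Ideal.span {f})
    (h' : ∀ g, f' * g ∈ I' ↔ g ∈ H') (hU' : U' = I' ⊔ Ideal.span {f'})
    (a : R) (ha : ∀ g ∈ H, a * g ∈ H') (hf : f = f' * a) (hI : I ≤ I') (hUU : U ≤ U')
    (t : tHom P (i + 1) (R ⧸ U)) :
    colonDelta P i h' hU' (tMap P (i + 1) (Submodule.factor hUU) t) =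
      tMap P i (mulQ a ha) (colonDelta P i h hU t) := by
  refine (colonSes f H I U h hU).delta_naturality (colonSes f' H' I' U' h' hU')
    (mulQ a ha) (Submodule.factor hI) (Submodule.factor hUU) ?_ ?_ i t
  · refine quot_hom_ext fun g => ?_
    change (Submodule.Quotient.mk (f * g) : R ⧸ I') = Submodule.Quotient.mk (f' * (a * g))
    rw [hf, mul_assoc]
  · exact quot_hom_ext fun g => rfl

lemma colonDelta_naturality_factor (i : ℕ) {f : R} {H I U H' I' U' : Ideal R}
    (h : ∀ g, f * g ∈ I ↔ g ∈ H) (hU : U = I ⊔ Ideal.span {f})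
    (h' : ∀ g, f * g ∈ I' ↔ g ∈ H') (hU' : U' = I' ⊔ Ideal.span {f})
    (hH : H ≤ H') (hI : I ≤ I') (hUU : U ≤ U') (t : tHom P (i + 1) (R ⧸ U)) :
    colonDelta P i h' hU' (tMap P (i + 1) (Submodule.factor hUU) t) =
      tMap P i (Submodule.factor hH) (colonDelta P i h hU t) := by
  rw [colonDelta_naturality P i h hU h' hU' 1 (fun g hg => by rw [one_mul]; exact hH hg)
    (mul_one f).symm hI hUU]
  congr 2
  refine quot_hom_ext fun g => ?_
  rw [mulQ_mk, one_mul, factor_quot_mk]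

end ColonDelta

/-- The image of an ideal `Y` in `R/X`. -/
abbrev subq (X Y : Ideal R) : Submodule R (R ⧸ X) := Submodule.map X.mkQ Y

/-- The sequence `0 → (X+Y)/X → R/X → R/(X+cY) → 0`, where the first map is multiplication
by a nonzerodivisor `c` on `R/X`. -/
def subqSes (c : R) (X Y U : Ideal R) (h : ∀ g, c * g ∈ X → g ∈ X)
    (hU : U = X ⊔ Ideal.span {c} * Y) : Ses R (subq X Y) (R ⧸ X) (R ⧸ U) where
  f := c • (subq X Y).subtype
  g := Submodule.factor (hU ▸ le_sup_left)
  inj := by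
    rw [← LinearMap.ker_eq_bot, LinearMap.ker_eq_bot']
    rintro ⟨t, ht⟩ h0
    obtain ⟨g, rfl⟩ := Submodule.Quotient.mk_surjective _ t
    have : (Submodule.Quotient.mk (c * g) : R ⧸ X) = 0 := h0
    rw [Submodule.Quotient.mk_eq_zero] at this
    exact Subtype.ext ((Submodule.Quotient.mk_eq_zero _).2 (h _ this))
  exact := by
    intro t
    obtain ⟨g, rfl⟩ := Submodule.Quotient.mk_surjective _ t
    rw [factor_quot_mk, Submodule.Quotient.mk_eq_zero, hU, Submodule.mem_sup]
    constructor
    · rintro ⟨a, ha, b, hb, rfl⟩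
      obtain ⟨z, hz, rfl⟩ := Ideal.mem_span_singleton_mul.1 hb
      refine ⟨⟨Submodule.Quotient.mk z, Submodule.mem_map_of_mem hz⟩, ?_⟩
      change (Submodule.Quotient.mk (c * z) : R ⧸ X) = _
      rw [Submodule.Quotient.eq]
      simpa using ha
    · rintro ⟨⟨_, y, hy, rfl⟩, hs⟩
      have : (Submodule.Quotient.mk (c * y) : R ⧸ X) = Submodule.Quotient.mk g := hs
      rw [Submodule.Quotient.eq] at this
      exact ⟨g - c * y, by simpa using X.neg_mem this, c * y,
        Ideal.mul_mem_mul (Ideal.mem_span_singleton_self c) hy, by ring⟩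
  surj := Submodule.factor_surjective _

end Quotients

section VariableIdeals

variable {K : Type u} [Field K] {σ : Type}

variable (K) in
/-- The ideal generated by a set of variables. -/
noncomputable def varIdeal (S : Set σ) : Ideal (MvPolynomial σ K) :=
  Ideal.span (MvPolynomial.X '' S)

lemma mem_varIdeal {S : Set σ} {f : MvPolynomial σ K} :
    f ∈ varIdeal K S ↔ ∀ m ∈ f.support, ∃ i ∈ S, m i ≠ 0 :=
  MvPolynomial.mem_ideal_span_X_image

lemma X_mem_varIdeal {S : Set σ} {v : σ} (hv : v ∈ S) :
    (MvPolynomial.X v : MvPolynomial σ K) ∈ varIdeal K S :=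
  Ideal.subset_span ⟨v, hv, rfl⟩

lemma varIdeal_mono {S T : Set σ} (h : S ⊆ T) : varIdeal K S ≤ varIdeal K T :=
  Ideal.span_mono (Set.image_mono h)

lemma varIdeal_empty : varIdeal K (∅ : Set σ) = ⊥ := by
  rw [varIdeal, Set.image_empty, Ideal.span_empty]

lemma varIdeal_union (S T : Set σ) : varIdeal K (S ∪ T) = varIdeal K S ⊔ varIdeal K T := by
  rw [varIdeal, Set.image_union, Ideal.span_union]; rfl

lemma varIdeal_insert (S : Set σ) (v : σ) :
    varIdeal K (insert v S) = varIdeal K S ⊔ Ideal.span {MvPolynomial.X v} := by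
  rw [Set.insert_eq, Set.union_comm, varIdeal_union]
  simp [varIdeal]

lemma X_mul_mem_varIdeal {S : Set σ} {v : σ} (hv : v ∉ S) (f : MvPolynomial σ K) :
    MvPolynomial.X v * f ∈ varIdeal K S ↔ f ∈ varIdeal K S := by
  refine ⟨fun h => ?_, fun h => Ideal.mul_mem_left _ _ h⟩
  rw [mem_varIdeal] at h ⊢
  intro m hm
  obtain ⟨i, hi, h0⟩ := h (Finsupp.single v 1 + m) (by
    rw [MvPolynomial.mem_support_iff, MvPolynomial.coeff_X_mul]
    exact MvPolynomial.mem_support_iff.1 hm)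
  refine ⟨i, hi, ?_⟩
  have : v ≠ i := fun h => hv (h ▸ hi)
  simpa [Finsupp.single_apply, this] using h0

lemma X_sq_mul_mem_varIdeal {S : Set σ} {v : σ} (hv : v ∉ S) (f : MvPolynomial σ K) :
    MvPolynomial.X v ^ 2 * f ∈ varIdeal K S ↔ f ∈ varIdeal K S := by
  rw [pow_two, mul_assoc, X_mul_mem_varIdeal hv, X_mul_mem_varIdeal hv]

variable {P : ChainComplex (ModuleCat.{u} (MvPolynomial σ K)) ℕ}

section
variable (hk : Kills P (Ideal.span (Set.range MvPolynomial.X)))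
include hk

lemma tZero_X_smul {X Y : Type u} [AddCommGroup X] [Module (MvPolynomial σ K) X]
    [AddCommGroup Y] [Module (MvPolynomial σ K) Y] (v : σ) (f : X →ₗ[MvPolynomial σ K] Y) :
    TZero P ((MvPolynomial.X v : MvPolynomial σ K) • f) :=
  hk.smul (Ideal.subset_span ⟨v, rfl⟩) f

lemma tZero_mulQ_X (v : σ) {H I : Ideal (MvPolynomial σ K)} (hHI : H ≤ I)
    (h : ∀ g ∈ H, MvPolynomial.X v * g ∈ I) :
    TZero P (mulQ (MvPolynomial.X v) h) := by
  have : mulQ (MvPolynomial.X v) h = (MvPolynomial.X v : MvPolynomial σ K) •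
      Submodule.factor hHI := quot_hom_ext fun g => rfl
  rw [this]
  exact tZero_X_smul hk v _

variable [∀ i, Projective (P.X i)]

lemma tInj_varIdeal_insert {S : Set σ} {v : σ} (hv : v ∉ S) {U : Ideal (MvPolynomial σ K)}
    (hU : U = varIdeal K S ⊔ Ideal.span {MvPolynomial.X v}) (h : varIdeal K S ≤ U) :
    TInj P (Submodule.factor h) :=
  Ses.tInj_of_tZero (s := colonSes _ _ _ _ (X_mul_mem_varIdeal hv) hU) (tZero_mulQ_X hk v le_rfl (fun g hg => (X_mul_mem_varIdeal hv g).2 hg))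

lemma tInj_varIdeal_union (S : Set σ) (T : Finset σ) {U : Ideal (MvPolynomial σ K)}
    (hU : U = varIdeal K (S ∪ T)) (h : varIdeal K S ≤ U) : TInj P (Submodule.factor h) := by
  classical
  subst hU
  induction T using Finset.induction_on with
  | empty =>
    have key : ∀ S' : Set σ, S' = S → ∀ h : varIdeal K S ≤ varIdeal K S',
        TInj P (Submodule.factor h) := by
      rintro _ rfl h
      convert tInj_id using 1
      exact quot_hom_ext fun g => rfl
    exact key _ (by simp) h
  | insert a T ha ih =>
    have h1 : varIdeal K S ≤ varIdeal K (S ∪ T) := varIdeal_mono Set.subset_union_left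
    by_cases hv : a ∈ S ∪ (T : Set σ)
    · have key : ∀ S' : Set σ, S' = S ∪ T → ∀ h : varIdeal K S ≤ varIdeal K S',
        TInj P (Submodule.factor h) := by
        rintro _ rfl h
        exact ih h
      exact key _ (by rw [Finset.coe_insert, Set.union_insert, Set.insert_eq_of_mem hv]) h
    · have h2 : varIdeal K (S ∪ (insert a T : Finset σ)) =
          varIdeal K (S ∪ T) ⊔ Ideal.span {MvPolynomial.X a} := by
        rw [Finset.coe_insert, Set.union_insert, varIdeal_insert]
      have h3 : varIdeal K (S ∪ T) ≤ varIdeal K (S ∪ (insert a T : Finset σ)) :=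
        h2 ▸ le_sup_left
      have h4 : Submodule.factor h = Submodule.factor h3 ∘ₗ Submodule.factor h1 :=
        quot_hom_ext fun g => rfl
      rw [h4]
      exact (tInj_varIdeal_insert hk hv h2 h3).comp (ih h1)

lemma tLen_varIdeal (h0 : tLen P 0 (MvPolynomial σ K) = 1)
    (hs : ∀ i, tLen P (i + 1) (MvPolynomial σ K) = 0) (S : Finset σ) (i : ℕ) :
    tLen P i (MvPolynomial σ K ⧸ varIdeal K (S : Set σ)) = (S.card.choose i : ℕ) := by
  classical
  induction S using Finset.induction_on generalizing i with
  | empty =>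
    have e := Submodule.quotEquivOfEqBot (varIdeal K ((∅ : Finset σ) : Set σ))
      (by rw [Finset.coe_empty, varIdeal_empty])
    rw [tLen_congr e]
    rcases i with _ | i
    · simpa using h0
    · simpa using hs i
  | insert a S ha ih =>
    have hv : a ∉ (S : Set σ) := by simpa using ha
    have h2 : varIdeal K ((insert a S : Finset σ) : Set σ) =
        varIdeal K (S : Set σ) ⊔ Ideal.span {MvPolynomial.X a} := by
      rw [Finset.coe_insert, varIdeal_insert]
    have hz := tZero_mulQ_X hk a (le_refl (varIdeal K (S : Set σ)))
      (fun g hg => (X_mul_mem_varIdeal hv g).2 hg)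
    rw [Finset.card_insert_of_notMem ha]
    rcases i with _ | i
    · rw [Ses.tLen_zero (s := colonSes _ _ _ _ (X_mul_mem_varIdeal hv) h2) hz, ih]; simp
    · rw [Ses.tLen_succ (s := colonSes _ _ _ _ (X_mul_mem_varIdeal hv) h2) hz, ih, ih, Nat.choose_succ_succ]
      push_cast; ring

end

/-- A class in `T(R/(S₀ ∪ S))` killed by the connecting maps of all variables in `U ⊆ S` comes
from `T(R/(S₀ ∪ S ∖ U))`. -/
lemma mem_range_of_delta_eq_zero [DecidableEq σ] [∀ i, Projective (P.X i)]
    (hk : Kills P (Ideal.span (Set.range MvPolynomial.X)))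
    {S₀ : Set σ} {S : Finset σ} (hd : ∀ v ∈ S, v ∉ S₀) {I : Ideal (MvPolynomial σ K)}
    (hI : I = varIdeal K (S₀ ∪ S)) (i : ℕ) (t : tHom P (i + 1) (MvPolynomial σ K ⧸ I))
    (ht : ∀ v (hv : v ∉ S₀ ∪ ((S.erase v : Finset σ) : Set σ))
      (hU : I = varIdeal K (S₀ ∪ ((S.erase v : Finset σ) : Set σ)) ⊔
        Ideal.span {MvPolynomial.X v}), colonDelta P i (X_mul_mem_varIdeal hv) hU t = 0)
    (U : Finset σ) (hUS : U ⊆ S) (h : varIdeal K (S₀ ∪ ((S \ U : Finset σ) : Set σ)) ≤ I) :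
    t ∈ LinearMap.range (tMap P (i + 1) (Submodule.factor h)) := by
  induction U using Finset.induction_on with
  | empty =>
    have key : ∀ J, J = I → ∀ h : J ≤ I,
        t ∈ LinearMap.range (tMap P (i + 1) (Submodule.factor h)) := by
      rintro _ rfl h
      have : Submodule.factor h = LinearMap.id := quot_hom_ext fun g => rfl
      rw [this, tMap_id]
      exact ⟨t, rfl⟩
    exact key _ (by rw [hI]; simp) h
  | insert w U hw ih =>
    have hwS : w ∈ S := hUS (Finset.mem_insert_self _ _)
    have h1 : varIdeal K (S₀ ∪ ((S \ U : Finset σ) : Set σ)) ≤ I := by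
      rw [hI]
      exact varIdeal_mono (Set.union_subset_union_right _ (by simp))
    obtain ⟨t', ht'⟩ := ih ((Finset.subset_insert _ _).trans hUS) h1
    have hv' : w ∉ S₀ ∪ ((S \ insert w U : Finset σ) : Set σ) := by
      simp [hd w hwS]
    have hv : w ∉ S₀ ∪ ((S.erase w : Finset σ) : Set σ) := by
      simp [hd w hwS]
    have hU' : varIdeal K (S₀ ∪ ((S \ U : Finset σ) : Set σ)) =
        varIdeal K (S₀ ∪ ((S \ insert w U : Finset σ) : Set σ)) ⊔
          Ideal.span {MvPolynomial.X w} := by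
      rw [← varIdeal_insert, ← Set.union_insert, ← Finset.coe_insert]
      congr 3
      ext x
      simp only [Finset.mem_sdiff, Finset.mem_insert]
      by_cases hx : x = w
      · subst hx; simp [hwS, hw]
      · simp [hx]
    have hU : I = varIdeal K (S₀ ∪ ((S.erase w : Finset σ) : Set σ)) ⊔
        Ideal.span {MvPolynomial.X w} := by
      rw [← varIdeal_insert, ← Set.union_insert, ← Finset.coe_insert, Finset.insert_erase hwS, hI]
    have h2 : S₀ ∪ ((S \ insert w U : Finset σ) : Set σ) ⊆
        S₀ ∪ ((S.erase w : Finset σ) : Set σ) := by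
      refine Set.union_subset_union_right _ ?_
      intro x
      simp only [Finset.coe_sdiff, Finset.coe_insert, Finset.coe_erase]
      grind
    have h3 := colonDelta_naturality_factor P i (X_mul_mem_varIdeal hv') hU'
      (X_mul_mem_varIdeal hv) hU (varIdeal_mono h2) (varIdeal_mono h2) h1 t'
    rw [ht', ht w hv hU] at h3
    have h4 : TInj P (Submodule.factor (varIdeal_mono (K := K) h2)) := by
      apply tInj_varIdeal_union hk _ (S.erase w)
      rw [Set.union_assoc, ← Finset.coe_union]
      congr 3
      ext x
      simp only [Finset.mem_union, Finset.mem_sdiff, Finset.mem_erase, Finset.mem_insert]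
      tauto
    have h5 : colonDelta P i (X_mul_mem_varIdeal hv') hU' t' = 0 :=
      (injective_iff_map_eq_zero _).1 (h4 i) _ h3.symm
    have h6 : varIdeal K (S₀ ∪ ((S \ insert w U : Finset σ) : Set σ)) ≤
        varIdeal K (S₀ ∪ ((S \ U : Finset σ) : Set σ)) := hU' ▸ le_sup_left
    obtain ⟨t'', ht''⟩ := (colonDelta_eq_zero_iff P i (X_mul_mem_varIdeal hv') hU' h6 t').1 h5
    refine ⟨t'', ?_⟩
    rw [← ht', ← ht'', tMap_factor_factor P (i + 1) h6 h1 h]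

/-- If `I` contains no terms that are linear in one of the variables in `S` modulo the others,
the image of `T(R/I)` in `T(R/(S₀ ∪ S))` is contained in the image of `T(R/(S₀))`. -/
lemma tMap_mem_range_of_sq [DecidableEq σ] [∀ i, Projective (P.X i)]
    (hk : Kills P (Ideal.span (Set.range MvPolynomial.X)))
    {S₀ : Set σ} {S : Finset σ} (hd : ∀ v ∈ S, v ∉ S₀) {I J : Ideal (MvPolynomial σ K)}
    (hJ : J = varIdeal K (S₀ ∪ S))
    (hI : ∀ v ∈ S, I ≤ varIdeal K (S₀ ∪ ((S.erase v : Finset σ) : Set σ)) ⊔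
      Ideal.span {MvPolynomial.X v ^ 2})
    (hIJ : I ≤ J) (h : varIdeal K S₀ ≤ J) (i : ℕ) (t : tHom P i (MvPolynomial σ K ⧸ I)) :
    tMap P i (Submodule.factor hIJ) t ∈ LinearMap.range (tMap P i (Submodule.factor h)) := by
  rcases i with _ | i
  · rw [LinearMap.range_eq_top.2 (tMap_zero_surjective P (Submodule.factor_surjective h))]
    exact Submodule.mem_top
  have hS : varIdeal K (S₀ ∪ ((S \ S : Finset σ) : Set σ)) = varIdeal K S₀ := by simp
  rw [← range_tMap_factor_congr P (i + 1) hS (hS ▸ h) h]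
  refine mem_range_of_delta_eq_zero hk hd hJ i _ ?_ S subset_rfl _
  intro v hv hU
  by_cases hvS : v ∈ S
  · set B := varIdeal K (S₀ ∪ ((S.erase v : Finset σ) : Set σ)) with hB
    have hle : B ⊔ Ideal.span {MvPolynomial.X v ^ 2} ≤ J := by
      rw [hU]
      refine sup_le_sup_left ?_ _
      rw [Ideal.span_singleton_le_span_singleton]
      exact dvd_pow_self _ two_ne_zero
    rw [← tMap_factor_factor P (i + 1) (hI v hvS) hle hIJ]
    rw [colonDelta_naturality P i (X_sq_mul_mem_varIdeal hv) rfl (X_mul_mem_varIdeal hv) hU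
      (MvPolynomial.X v) (fun g hg => Ideal.mul_mem_left _ _ hg) (pow_two _) le_rfl hle,
      tZero_mulQ_X hk v le_rfl _ i, LinearMap.zero_apply]
  · have h1 : S₀ ∪ ((S.erase v : Finset σ) : Set σ) = S₀ ∪ S := by
      rw [Finset.erase_eq_of_notMem hvS]
    have h2 : MvPolynomial.X v ∈ varIdeal K (S₀ ∪ ((S.erase v : Finset σ) : Set σ)) := by
      rw [h1, ← hJ, hU]
      exact Ideal.mem_sup_right (Ideal.mem_span_singleton_self _)
    rw [← mul_one (MvPolynomial.X v), X_mul_mem_varIdeal hv, mem_varIdeal] at h2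
    obtain ⟨i, -, hi⟩ := h2 0 (by simp)
    simp at hi

end VariableIdeals

section SubqDelta

variable {R : Type u} [CommRing R] (P : ChainComplex (ModuleCat.{u} R) ℕ)
  [∀ i, Projective (P.X i)]

/-- The connecting homomorphism of `subqSes`. -/
noncomputable def subqDelta (i : ℕ) {c : R} {X Y U : Ideal R} (h : ∀ g, c * g ∈ X → g ∈ X)
    (hU : U = X ⊔ Ideal.span {c} * Y) : tHom P (i + 1) (R ⧸ U) →ₗ[R] tHom P i (subq X Y) :=
  (subqSes c X Y U h hU).delta P i

lemma subqDelta_eq_zero_iff (i : ℕ) {c : R} {X Y U : Ideal R} (h : ∀ g, c * g ∈ X → g ∈ X)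
    (hU : U = X ⊔ Ideal.span {c} * Y) (hXU : X ≤ U) (t : tHom P (i + 1) (R ⧸ U)) :
    subqDelta P i h hU t = 0 ↔ t ∈ LinearMap.range (tMap P (i + 1) (Submodule.factor hXU)) :=
  (subqSes c X Y U h hU).exact_right i t

lemma subqDelta_surjective (i : ℕ) {c : R} {X Y U : Ideal R} (h : ∀ g, c * g ∈ X → g ∈ X)
    (hU : U = X ⊔ Ideal.span {c} * Y) (hz : TZero P (c • (subq X Y).subtype)) :
    Function.Surjective (subqDelta P i h hU) :=
  Ses.delta_surjective (s := subqSes c X Y U h hU) hz i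

lemma subqDelta_naturality (i : ℕ) {c : R} {X Y Y₂ U U₂ : Ideal R} (h : ∀ g, c * g ∈ X → g ∈ X)
    (hU : U = X ⊔ Ideal.span {c} * Y) (hU₂ : U₂ = X ⊔ Ideal.span {c} * Y₂) (hUU : U₂ ≤ U)
    (hY : subq X Y₂ ≤ subq X Y) (t : tHom P (i + 1) (R ⧸ U₂)) :
    subqDelta P i h hU (tMap P (i + 1) (Submodule.factor hUU) t) =
      tMap P i (Submodule.inclusion hY) (subqDelta P i h hU₂ t) := by
  refine (subqSes c X Y₂ U₂ h hU₂).delta_naturality (subqSes c X Y U h hU)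
    (Submodule.inclusion hY) LinearMap.id (Submodule.factor hUU) ?_ ?_ i t
  · rfl
  · exact quot_hom_ext fun g => rfl

lemma tLen_subq {c : R} {X Y U : Ideal R} (h : ∀ g, c * g ∈ X → g ∈ X)
    (hU : U = X ⊔ Ideal.span {c} * Y) (hz : TZero P (c • (subq X Y).subtype)) (i : ℕ) :
    tLen P (i + 1) (R ⧸ U) = tLen P (i + 1) (R ⧸ X) + tLen P i (subq X Y) :=
  Ses.tLen_succ (s := subqSes c X Y U h hU) hz i

lemma tLen_zero_subq {c : R} {X Y U : Ideal R} (h : ∀ g, c * g ∈ X → g ∈ X)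
    (hU : U = X ⊔ Ideal.span {c} * Y) (hz : TZero P (c • (subq X Y).subtype)) :
    tLen P 0 (R ⧸ U) = tLen P 0 (R ⧸ X) :=
  Ses.tLen_zero (s := subqSes c X Y U h hU) hz

variable {P}

lemma tInj_subq {c : R} {X Y U : Ideal R} (h : ∀ g, c * g ∈ X → g ∈ X)
    (hU : U = X ⊔ Ideal.span {c} * Y) (hz : TZero P (c • (subq X Y).subtype)) (hXU : X ≤ U) :
    TInj P (Submodule.factor hXU) :=
  Ses.tInj_of_tZero (s := subqSes c X Y U h hU) hz

lemma tZero_subq {c : R} {X Y U : Ideal R} (h : ∀ g, c * g ∈ X → g ∈ X)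
    (hU : U = X ⊔ Ideal.span {c} * Y) (hXU : X ≤ U) (hi : TInj P (Submodule.factor hXU)) :
    TZero P (c • (subq X Y).subtype) :=
  Ses.tZero_of_tInj (s := subqSes c X Y U h hU) hi

end SubqDelta

section JIdeal

variable {K : Type u} [Field K] {σ : Type} [DecidableEq σ]
variable {P : ChainComplex (ModuleCat.{u} (MvPolynomial σ K)) ℕ} [∀ i, Projective (P.X i)]
variable (hk : Kills P (Ideal.span (Set.range MvPolynomial.X)))

omit [DecidableEq σ] in
lemma one_mul_mem_varIdeal (S : Set σ) (g : MvPolynomial σ K) (h : 1 * g ∈ varIdeal K S) :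
    g ∈ varIdeal K S := by rwa [one_mul] at h

omit [DecidableEq σ] in
lemma varIdeal_union_eq (x y : Finset σ) : varIdeal K ((x : Set σ) ∪ y) =
    varIdeal K (x : Set σ) ⊔ Ideal.span {1} * varIdeal K (y : Set σ) := by
  rw [varIdeal_union, Ideal.span_singleton_one, Ideal.top_mul]

include hk

omit [DecidableEq σ] in
lemma tZero_subq_one (x y : Finset σ) :
    TZero P ((1 : MvPolynomial σ K) • (subq (varIdeal K (x : Set σ))
      (varIdeal K (y : Set σ))).subtype) :=
  tZero_subq (one_mul_mem_varIdeal _) (varIdeal_union_eq x y)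
    (varIdeal_mono Set.subset_union_left) (tInj_varIdeal_union hk _ y rfl _)

/-- The ideal `(x) + c (y)`, for sets of variables `x` and `y`, has the same Betti numbers
as `(x, y)`. -/
lemma tLen_jIdeal (h0 : tLen P 0 (MvPolynomial σ K) = 1)
    (hs : ∀ i, tLen P (i + 1) (MvPolynomial σ K) = 0) {x y : Finset σ} (hxy : Disjoint x y)
    {c : σ} (hc : c ∉ x) {J : Ideal (MvPolynomial σ K)}
    (hJ : J = varIdeal K (x : Set σ) ⊔ Ideal.span {MvPolynomial.X c} * varIdeal K (y : Set σ))
    (i : ℕ) : tLen P i (MvPolynomial σ K ⧸ J) = ((x.card + y.card).choose i : ℕ) := by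
  have hc' : ∀ g, MvPolynomial.X c * g ∈ varIdeal K (x : Set σ) → g ∈ varIdeal K (x : Set σ) :=
    fun g => (X_mul_mem_varIdeal (by simpa using hc) g).1
  have e : varIdeal K ((x ∪ y : Finset σ) : Set σ) =
    varIdeal K (x : Set σ) ⊔ Ideal.span {1} * varIdeal K (y : Set σ) := by
    rw [Finset.coe_union]; exact varIdeal_union_eq x y
  have hz : TZero P ((MvPolynomial.X c : MvPolynomial σ K) • (subq (varIdeal K (x : Set σ))
      (varIdeal K (y : Set σ))).subtype) := tZero_X_smul hk c _
  rw [← Finset.card_union_of_disjoint hxy, ← tLen_varIdeal hk h0 hs]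
  rcases i with _ | i
  · rw [tLen_zero_subq P hc' hJ hz,
      tLen_zero_subq P (one_mul_mem_varIdeal _) e (tZero_subq_one hk x y)]
  · rw [tLen_subq P hc' hJ hz,
      tLen_subq P (one_mul_mem_varIdeal _) e (tZero_subq_one hk x y)]

omit [∀ i, Projective (P.X i)] hk in
lemma varIdeal_sup_sq_le (x y : Finset σ) (v : σ) :
    varIdeal K (x : Set σ) ⊔ Ideal.span {1} * varIdeal K (y : Set σ) ^ 2 ≤
      varIdeal K ((x : Set σ) ∪ ((y.erase v : Finset σ) : Set σ)) ⊔
        Ideal.span {MvPolynomial.X v ^ 2} := by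
  refine sup_le ((varIdeal_mono Set.subset_union_left).trans le_sup_left) ?_
  rw [Ideal.span_singleton_one, Ideal.top_mul]
  have h1 : varIdeal K (y : Set σ) ≤
      varIdeal K ((y.erase v : Finset σ) : Set σ) ⊔ Ideal.span {MvPolynomial.X v} := by
    rw [← varIdeal_insert]
    refine varIdeal_mono ?_
    rw [← Finset.coe_insert]
    exact Finset.coe_subset.2 (fun z hz => by grind)
  refine (Ideal.pow_right_mono h1 2).trans ?_
  rw [pow_two, Ideal.sup_mul, Ideal.mul_sup (Ideal.span _), Ideal.span_singleton_mul_span_singleton,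
    ← pow_two]
  refine sup_le (Ideal.mul_le_left.trans ?_) (sup_le (Ideal.mul_le_right.trans ?_) le_sup_right)
  all_goals exact (varIdeal_mono Set.subset_union_right).trans le_sup_left

/-- The inclusion of `(x) + (y)²` into `(x) + (y)`, modulo `(x)`, induces zero on `T`. -/
lemma tZero_inclusion_sq {x y : Finset σ} (hxy : Disjoint x y)
    (hY : subq (varIdeal K (x : Set σ)) (varIdeal K (y : Set σ) ^ 2) ≤
      subq (varIdeal K (x : Set σ)) (varIdeal K (y : Set σ))) :
    TZero P (Submodule.inclusion hY) := by
  intro i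
  ext t
  have hle : varIdeal K (x : Set σ) ⊔ Ideal.span {1} * varIdeal K (y : Set σ) ^ 2 ≤
      varIdeal K ((x : Set σ) ∪ y) := by
    rw [varIdeal_union_eq]
    exact sup_le_sup_left (Ideal.mul_mono_right (Ideal.pow_le_self two_ne_zero)) _
  have hz : TZero P ((1 : MvPolynomial σ K) • (subq (varIdeal K (x : Set σ))
      (varIdeal K (y : Set σ) ^ 2)).subtype) :=
    (tZero_subq_one hk x y).comp_right (Submodule.inclusion hY)
  obtain ⟨s, rfl⟩ := subqDelta_surjective P i (one_mul_mem_varIdeal _) rfl hz t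
  rw [← subqDelta_naturality P i (one_mul_mem_varIdeal _) (varIdeal_union_eq x y) rfl hle hY,
    LinearMap.zero_apply, subqDelta_eq_zero_iff P i _ _ (varIdeal_mono Set.subset_union_left)]
  exact tMap_mem_range_of_sq hk (S₀ := (x : Set σ)) (S := y)
    (fun v hv hv' => Finset.disjoint_left.1 hxy (by simpa using hv') hv) rfl
    (fun v _ => varIdeal_sup_sq_le x y v) hle _ (i + 1) s

/-- The image of `T(R/I)` in `T(R/J)`, for `J = (x) + c (y)`, when `I ⊇ (x₀)` has no terms of
low degree in the other variables. -/
lemma range_tMap_jIdeal {x y : Finset σ} (hxy : Disjoint x y) {c x₀ : σ} (hc : c ∉ x) (hx₀ : x₀ ∈ x)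
    {I J : Ideal (MvPolynomial σ K)}
    (hJ : J = varIdeal K (x : Set σ) ⊔ Ideal.span {MvPolynomial.X c} * varIdeal K (y : Set σ))
    (hI₀ : varIdeal K {x₀} ≤ I)
    (hI₂ : I ≤ varIdeal K (x : Set σ) ⊔ Ideal.span {MvPolynomial.X c} * varIdeal K (y : Set σ) ^ 2)
    (hI : ∀ v ∈ x.erase x₀ ∪ y, I ≤
      varIdeal K ({x₀} ∪ (((x.erase x₀ ∪ y).erase v : Finset σ) : Set σ)) ⊔
      Ideal.span {MvPolynomial.X v ^ 2}) (hIJ : I ≤ J) (i : ℕ) :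
    Module.length (MvPolynomial σ K) (LinearMap.range (tMap P i (Submodule.factor hIJ))) =
      tLen P i (MvPolynomial σ K ⧸ varIdeal K {x₀}) := by
  have hc' : ∀ g, MvPolynomial.X c * g ∈ varIdeal K (x : Set σ) → g ∈ varIdeal K (x : Set σ) :=
    fun g => (X_mul_mem_varIdeal (by simpa using hc) g).1
  have hz : TZero P ((MvPolynomial.X c : MvPolynomial σ K) • (subq (varIdeal K (x : Set σ))
      (varIdeal K (y : Set σ))).subtype) := tZero_X_smul hk c _
  have hXJ : varIdeal K (x : Set σ) ≤ J := hJ ▸ le_sup_left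
  have hx₀x : ({x₀} : Set σ) ∪ x = x := by simpa using hx₀
  have h0X : varIdeal K {x₀} ≤ varIdeal K (x : Set σ) := varIdeal_mono (by simpa using hx₀)
  have inj1 : TInj P (Submodule.factor h0X) := tInj_varIdeal_union hk _ x (by rw [hx₀x]) _
  have inj2 : TInj P (Submodule.factor hXJ) := tInj_subq hc' hJ hz hXJ
  have h0J : varIdeal K {x₀} ≤ J := hI₀.trans hIJ
  have inj3 : Function.Injective (tMap P i (Submodule.factor h0J)) := by
    intro a b hab
    rw [← tMap_factor_factor P i h0X hXJ, ← tMap_factor_factor P i h0X hXJ] at hab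
    exact inj1 i (inj2 i hab)
  have hrange : LinearMap.range (tMap P i (Submodule.factor hIJ)) =
      LinearMap.range (tMap P i (Submodule.factor h0J)) := by
    apply le_antisymm
    · rintro _ ⟨t, rfl⟩
      rcases i with _ | i
      · rw [LinearMap.range_eq_top.2 (tMap_zero_surjective P (Submodule.factor_surjective h0J))]
        exact Submodule.mem_top
      have hJ₂J : varIdeal K (x : Set σ) ⊔ Ideal.span {MvPolynomial.X c} *
          varIdeal K (y : Set σ) ^ 2 ≤ J := by
        rw [hJ]
        exact sup_le_sup_left (Ideal.mul_mono_right (Ideal.pow_le_self two_ne_zero)) _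
      have hY : subq (varIdeal K (x : Set σ)) (varIdeal K (y : Set σ) ^ 2) ≤
        subq (varIdeal K (x : Set σ)) (varIdeal K (y : Set σ)) :=
        Submodule.map_mono (Ideal.pow_le_self two_ne_zero)
      have h1 : subqDelta P i hc' hJ (tMap P (i + 1) (Submodule.factor hIJ) t) = 0 := by
        rw [← tMap_factor_factor P (i + 1) hI₂ hJ₂J,
          subqDelta_naturality P i hc' hJ rfl hJ₂J hY, tZero_inclusion_sq hk hxy hY i,
          LinearMap.zero_apply]
      obtain ⟨s, hs⟩ := (subqDelta_eq_zero_iff P i hc' hJ hXJ _).1 h1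
      have hu : (x : Set σ) ∪ y = {x₀} ∪ ((x.erase x₀ ∪ y : Finset σ) : Set σ) := by
        ext z
        by_cases hz : z = x₀
        · simp [hz, hx₀]
        · simp [hz]
      have hJD : J ≤ varIdeal K ((x : Set σ) ∪ y) := by
        rw [hJ, varIdeal_union]
        exact sup_le_sup_left Ideal.mul_le_right _
      have hXD := hXJ.trans hJD
      obtain ⟨w, hw⟩ := tMap_mem_range_of_sq hk (S₀ := {x₀}) (S := x.erase x₀ ∪ y)
        (J := varIdeal K ((x : Set σ) ∪ y)) (by
          intro v hv
          rw [Finset.mem_union] at hv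
          rintro rfl
          rcases hv with hv | hv
          · simp at hv
          · exact Finset.disjoint_left.1 hxy hx₀ hv)
        (by rw [hu]) hI (hIJ.trans hJD) (h0X.trans hXD) (i + 1) t
      have inj4 : TInj P (Submodule.factor hXD) := tInj_varIdeal_union hk _ y rfl _
      have h2 : s = tMap P (i + 1) (Submodule.factor h0X) w := by
        apply inj4 (i + 1)
        rw [tMap_factor_factor P (i + 1) h0X hXD (h0X.trans hXD), hw,
          ← tMap_factor_factor P (i + 1) hIJ hJD, ← hs, tMap_factor_factor P (i + 1) hXJ hJD hXD]
      refine ⟨w, ?_⟩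
      rw [← hs, h2, tMap_factor_factor P (i + 1) h0X hXJ h0J]
    · rintro _ ⟨t, rfl⟩
      refine ⟨tMap P i (Submodule.factor hI₀) t, ?_⟩
      rw [tMap_factor_factor P i hI₀ hIJ h0J]
  rw [hrange, length_range_of_injective _ inj3]
  rfl

end JIdeal

section BettiStep

lemma kalman_betti_recursion {r : ℕ} {b w u t wt : ℕ → ℕ}
    (hb : ∀ i, b i + 2 * r.choose (i + 1) = (2 * r).choose (i + 1) + Nat.choose 0 i)
    (hw0 : w 0 = b 0) (hw : ∀ i, w (i + 1) = b (i + 1) + b i)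
    (hu0 : u 0 = w 0) (hu : ∀ i, u (i + 1) = w (i + 1) + w i)
    (ht0 : wt 0 = t 0) (ht : ∀ i, wt (i + 1) = t (i + 1) + t i)
    (h0 : wt 0 + 1 = 1 + u 0)
    (h : ∀ i, wt (i + 1) + (Nat.choose 1 (i + 1) + Nat.choose 1 i) =
      (2 * r + 2).choose (i + 1) + u (i + 1)) (i : ℕ) :
    t i + 2 * (r + 1).choose (i + 1) = (2 * (r + 1)).choose (i + 1) + Nat.choose 0 i := by
  have e : 2 * (r + 1) = 2 * r + 2 := by ring
  rw [e]
  have p : ∀ k, (2 * r + 2).choose (k + 2) =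
      (2 * r).choose (k + 2) + 2 * (2 * r).choose (k + 1) + (2 * r).choose k := by
    intro k
    rw [Nat.choose_succ_succ, Nat.choose_succ_succ (2 * r), Nat.choose_succ_succ (2 * r)]
    ring
  have b0 := hb 0
  simp only [zero_add, Nat.choose_one_right, Nat.choose_zero_right] at b0
  induction i with
  | zero => simp; omega
  | succ i ih =>
    have h1 := h i
    have h2 := ht i
    have h3 := hu i
    have h4 := hw i
    have h5 := hb i
    have h6 := hb (i + 1)
    have h7 := p i
    rw [Nat.choose_succ_succ r] at ih
    rw [Nat.choose_succ_succ r]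
    rcases i with _ | i
    · simp [Nat.choose_one_right] at *
      omega
    · have h8 := hw i
      have h9 := hb i
      have h10 := p (i)
      rcases i with _ | i
      · simp [Nat.choose_one_right] at *
        omega
      · simp only [Nat.choose_zero_succ, Nat.choose_eq_zero_of_lt (show 1 < i + 1 + 1 by omega),
          Nat.choose_eq_zero_of_lt (show 1 < i + 1 + 1 + 1 by omega), Nat.succ_eq_add_one,
          add_assoc, Nat.reduceAdd] at *
        omega

variable {K : Type u} [Field K] {σ : Type} [DecidableEq σ]
variable {P : ChainComplex (ModuleCat.{u} (MvPolynomial σ K)) ℕ} [∀ i, Projective (P.X i)]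
variable (hk : Kills P (Ideal.span (Set.range MvPolynomial.X)))

section
omit [DecidableEq σ]
include hk

lemma tLen_zero_of_regular {I U : Ideal (MvPolynomial σ K)} {v : σ}
    (h : ∀ g, MvPolynomial.X v * g ∈ I → g ∈ I) (hU : U = I ⊔ Ideal.span {MvPolynomial.X v}) :
    tLen P 0 (MvPolynomial σ K ⧸ U) = tLen P 0 (MvPolynomial σ K ⧸ I) :=
  Ses.tLen_zero (s := colonSes _ I I U (fun g => ⟨h g, fun hg => Ideal.mul_mem_left _ _ hg⟩) hU)
    (tZero_mulQ_X hk v le_rfl (fun _ hg => Ideal.mul_mem_left _ _ hg))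

lemma tLen_succ_of_regular {I U : Ideal (MvPolynomial σ K)} {v : σ}
    (h : ∀ g, MvPolynomial.X v * g ∈ I → g ∈ I) (hU : U = I ⊔ Ideal.span {MvPolynomial.X v})
    (i : ℕ) : tLen P (i + 1) (MvPolynomial σ K ⧸ U) =
      tLen P (i + 1) (MvPolynomial σ K ⧸ I) + tLen P i (MvPolynomial σ K ⧸ I) :=
  Ses.tLen_succ (s := colonSes _ I I U (fun g => ⟨h g, fun hg => Ideal.mul_mem_left _ _ hg⟩) hU)
    (tZero_mulQ_X hk v le_rfl (fun _ hg => Ideal.mul_mem_left _ _ hg)) i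

lemma exists_tLen_of_regular {I U : Ideal (MvPolynomial σ K)} {v : σ}
    (h : ∀ g, MvPolynomial.X v * g ∈ I → g ∈ I) (hU : U = I ⊔ Ideal.span {MvPolynomial.X v})
    {b : ℕ → ℕ} (hb : ∀ i, tLen P i (MvPolynomial σ K ⧸ I) = b i) :
    ∃ w : ℕ → ℕ, (∀ i, tLen P i (MvPolynomial σ K ⧸ U) = w i) ∧ w 0 = b 0 ∧
      ∀ i, w (i + 1) = b (i + 1) + b i := by
  refine ⟨fun i => Nat.rec (b 0) (fun i _ => b (i + 1) + b i) i, fun i => ?_, rfl, fun i => rfl⟩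
  rcases i with _ | i
  · exact (tLen_zero_of_regular hk h hU).trans (hb 0)
  · rw [tLen_succ_of_regular hk h hU, hb, hb]
    push_cast
    rfl

end

include hk

/-- The recursion for Betti numbers under adding a row: `V` and `V'` are the ideals before and
after, `W = V' + (x₀)`, `U = V + (x₀, y₀) = W + (y₀)` and `J = (W : y₀) = (x) + c (y)`. -/
lemma exists_tLen_step (h0 : tLen P 0 (MvPolynomial σ K) = 1)
    (hs : ∀ i, tLen P (i + 1) (MvPolynomial σ K) = 0)
    {x y : Finset σ} (hxy : Disjoint x y) {c x₀ y₀ : σ} (hc : c ∉ x) (hx₀ : x₀ ∈ x)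
    {r : ℕ} (hx : x.card = r + 1) (hy : y.card = r + 1)
    {V V' I W U J : Ideal (MvPolynomial σ K)}
    (hJ : J = varIdeal K (x : Set σ) ⊔ Ideal.span {MvPolynomial.X c} * varIdeal K (y : Set σ))
    (hI : I = V ⊔ Ideal.span {MvPolynomial.X x₀})
    (hW : W = V' ⊔ Ideal.span {MvPolynomial.X x₀})
    (hU : U = I ⊔ Ideal.span {MvPolynomial.X y₀})
    (hU' : U = W ⊔ Ideal.span {MvPolynomial.X y₀})
    (hVV : V ≤ V')
    (hreg : ∀ g, MvPolynomial.X x₀ * g ∈ V → g ∈ V)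
    (hreg' : ∀ g, MvPolynomial.X x₀ * g ∈ V' → g ∈ V')
    (hregI : ∀ g, MvPolynomial.X y₀ * g ∈ I → g ∈ I)
    (hcol : ∀ g, MvPolynomial.X y₀ * g ∈ W ↔ g ∈ J)
    (hI₂ : I ≤ varIdeal K (x : Set σ) ⊔ Ideal.span {MvPolynomial.X c} * varIdeal K (y : Set σ) ^ 2)
    (hIsq : ∀ v ∈ x.erase x₀ ∪ y, I ≤
      varIdeal K ({x₀} ∪ (((x.erase x₀ ∪ y).erase v : Finset σ) : Set σ)) ⊔
      Ideal.span {MvPolynomial.X v ^ 2})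
    {b : ℕ → ℕ} (hb : ∀ i, tLen P i (MvPolynomial σ K ⧸ V) = b i)
    (hbr : ∀ i, b i + 2 * r.choose (i + 1) = (2 * r).choose (i + 1) + Nat.choose 0 i) :
    ∃ t : ℕ → ℕ, (∀ i, tLen P i (MvPolynomial σ K ⧸ V') = t i) ∧
      ∀ i, t i + 2 * (r + 1).choose (i + 1) = (2 * (r + 1)).choose (i + 1) + Nat.choose 0 i := by
  obtain ⟨w, hw, hw0, hws⟩ := exists_tLen_of_regular hk hreg hI hb
  obtain ⟨u, hu, hu0, hus⟩ := exists_tLen_of_regular hk hregI hU hw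
  have hIJ : I ≤ J := by
    rw [hJ]
    exact hI₂.trans (sup_le_sup_left (Ideal.mul_mono_right (Ideal.pow_le_self two_ne_zero)) _)
  have hI₀ : varIdeal K {x₀} ≤ I := by
    rw [hI, varIdeal, Set.image_singleton]
    exact le_sup_right
  have hIW : I ≤ W := by
    rw [hI, hW]
    exact sup_le_sup_right hVV _
  have hIcol : ∀ g, MvPolynomial.X y₀ * g ∈ I ↔ g ∈ I :=
    fun g => ⟨hregI g, fun hg => Ideal.mul_mem_left _ _ hg⟩
  have hrange : ∀ i, Module.length (MvPolynomial σ K)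
      (LinearMap.range (colonDelta P i hcol hU')) = (Nat.choose 1 i : ℕ) := by
    intro i
    have e : LinearMap.range (colonDelta P i hcol hU') =
        LinearMap.range (tMap P i (Submodule.factor hIJ)) := by
      have key : ∀ t, colonDelta P i hcol hU' t =
          tMap P i (Submodule.factor hIJ) (colonDelta P i hIcol hU t) := by
        intro t
        rw [← colonDelta_naturality_factor P i hIcol hU hcol hU' hIJ hIW le_rfl]
        congr 1
        have : Submodule.factor (le_refl U) = LinearMap.id := quot_hom_ext fun g => rfl
        rw [this, tMap_id, LinearMap.id_apply]
      apply le_antisymm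
      · rintro _ ⟨t, rfl⟩
        exact ⟨_, (key t).symm⟩
      · rintro _ ⟨t, rfl⟩
        obtain ⟨s, rfl⟩ := colonDelta_surjective P i hIcol hU
          (tZero_mulQ_X hk y₀ le_rfl (fun g hg => (hIcol g).2 hg)) t
        exact ⟨s, key s⟩
    rw [e, range_tMap_jIdeal hk hxy hc hx₀ hJ hI₀ hI₂ hIsq hIJ]
    have := tLen_varIdeal hk h0 hs {x₀} i
    rwa [Finset.card_singleton, Finset.coe_singleton] at this
  have e0 : tLen P 0 (MvPolynomial σ K ⧸ W) + ((1 : ℕ) : ℕ∞) = (1 : ℕ) + (u 0 : ℕ) := by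
    have h1 := Ses.tLen_range_zero (P := P) (s := colonSes _ J W U hcol hU')
    have h2 := hrange 0
    have h3 := tLen_jIdeal hk h0 hs hxy hc hJ 0
    rw [Nat.choose_zero_right] at h2 h3
    rw [h3, hu] at h1
    rw [← h1]
    exact congrArg _ h2.symm
  have e1 : ∀ i, tLen P (i + 1) (MvPolynomial σ K ⧸ W) +
      ((Nat.choose 1 (i + 1) + Nat.choose 1 i : ℕ) : ℕ∞) =
      ((2 * r + 2).choose (i + 1) : ℕ) + (u (i + 1) : ℕ) := by
    intro i
    have h1 := Ses.tLen_range_succ (P := P) (s := colonSes _ J W U hcol hU') i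
    have h2 := hrange i
    have h2' := hrange (i + 1)
    have h3 := tLen_jIdeal hk h0 hs hxy hc hJ (i + 1)
    rw [hx, hy, show r + 1 + (r + 1) = 2 * r + 2 by ring] at h3
    rw [h3, hu] at h1
    rw [← h1, Nat.cast_add, ← add_assoc, ← h2, ← h2']
    rfl
  have fin : ∀ i, tLen P i (MvPolynomial σ K ⧸ W) ≠ ⊤ := by
    intro i hi
    rcases i with _ | i
    · rw [hi, top_add, ← Nat.cast_add] at e0
      exact ENat.natCast_ne_top _ e0.symm
    · have := e1 i
      rw [hi, top_add, ← Nat.cast_add] at this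
      exact ENat.natCast_ne_top _ this.symm
  have fin' : ∀ i, tLen P i (MvPolynomial σ K ⧸ V') ≠ ⊤ := by
    intro i hi
    have := tLen_succ_of_regular (P := P) hk hreg' hW i
    rw [hi, add_top] at this
    exact fin _ this
  choose t ht using fun i => ENat.ne_top_iff_exists.1 (fin' i)
  obtain ⟨wt, hwt, hwt0, hwts⟩ := exists_tLen_of_regular hk hreg' hW (fun i => (ht i).symm)
  refine ⟨t, fun i => (ht i).symm, kalman_betti_recursion hbr hw0 hws hu0 hus hwt0 hwts ?_ ?_⟩
  · rw [hwt] at e0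
    exact_mod_cast e0
  · intro i
    have := e1 i
    rw [hwt] at this
    exact_mod_cast this

end BettiStep

section KillVars

open MvPolynomial

variable {K : Type u} [Field K] {σ : Type} [DecidableEq σ]

variable (K) in
/-- The substitution setting the variables in `S` to zero. -/
noncomputable def killVars (S : Finset σ) : MvPolynomial σ K →ₐ[K] MvPolynomial σ K :=
  aeval fun v => if v ∈ S then 0 else X v

lemma eval_killVars (S : Finset σ) (M : σ → K) (f : MvPolynomial σ K) :
    eval M (killVars K S f) = eval (fun v => if v ∈ S then 0 else M v) f := by
  have : (aeval M).comp (killVars K S) = aeval (fun v => if v ∈ S then 0 else M v) := by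
    ext v
    by_cases hv : v ∈ S <;> simp [killVars, hv]
  have := DFunLike.congr_fun this f
  simpa [aeval_eq_eval] using this

lemma sub_killVars_mem (S : Finset σ) (f : MvPolynomial σ K) :
    f - killVars K S f ∈ varIdeal K (S : Set σ) := by
  have : (Ideal.Quotient.mkₐ K (varIdeal K (S : Set σ))).comp (killVars K S) =
      Ideal.Quotient.mkₐ K (varIdeal K (S : Set σ)) := by
    ext v
    by_cases hv : v ∈ S
    · have : (Ideal.Quotient.mk (varIdeal K (S : Set σ))) (X v) = 0 :=
        Ideal.Quotient.eq_zero_iff_mem.2 (X_mem_varIdeal hv)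
      simp [killVars, hv, this]
    · simp [killVars, hv]
  have := DFunLike.congr_fun this f
  exact Ideal.Quotient.eq.1 this.symm

lemma killVars_killVars (S : Finset σ) (f : MvPolynomial σ K) :
    killVars K S (killVars K S f) = killVars K S f := by
  have : (killVars K S).comp (killVars K S) = killVars K S := by
    ext v
    by_cases hv : v ∈ S <;> simp [killVars, hv]
  exact DFunLike.congr_fun this f

lemma killVars_X_of_notMem {S : Finset σ} {v : σ} (hv : v ∉ S) :
    killVars K S (X v) = X v := by
  simp [killVars, hv]

lemma mem_varIdeal_iff_exists {S : Finset σ} {f : MvPolynomial σ K} :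
    f ∈ varIdeal K (S : Set σ) ↔ ∃ c : σ → MvPolynomial σ K, ∑ v ∈ S, c v * X v = f := by
  constructor
  · intro hf
    rw [varIdeal, Ideal.span, Submodule.mem_span_image_finset_iff_exists_fun] at hf
    obtain ⟨c, hc⟩ := hf
    refine ⟨fun v => if h : v ∈ S then c ⟨v, h⟩ else 0, ?_⟩
    rw [← hc, ← Finset.sum_coe_sort]
    refine Finset.sum_congr rfl fun v _ => ?_
    simp
  · rintro ⟨c, rfl⟩
    exact Ideal.sum_mem _ fun v hv => Ideal.mul_mem_left _ _ (X_mem_varIdeal hv)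

/-- The expansion of `f` to first order in the variables in `S`. -/
lemma exists_first_order (S : Finset σ) (f : MvPolynomial σ K) :
    ∃ A : σ → MvPolynomial σ K, (∀ v, killVars K S (A v) = A v) ∧
      f - killVars K S f - ∑ v ∈ S, A v * X v ∈ varIdeal K (S : Set σ) ^ 2 := by
  obtain ⟨c, hc⟩ := mem_varIdeal_iff_exists.1 (sub_killVars_mem S f)
  refine ⟨fun v => killVars K S (c v), fun v => killVars_killVars S _, ?_⟩
  rw [← hc, ← Finset.sum_sub_distrib]
  refine Ideal.sum_mem _ fun v hv => ?_
  rw [← sub_mul, pow_two]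
  exact Ideal.mul_mem_mul (sub_killVars_mem S _) (X_mem_varIdeal hv)

/-- If `f` vanishes along a line through the locus `S = 0`, then so do its terms of order zero and
one. -/
lemma eval_eq_zero_of_line [Infinite K] {S : Finset σ} {f f₀ : MvPolynomial σ K}
    {A : σ → MvPolynomial σ K} (h₀ : killVars K S f₀ = f₀) (hA : ∀ v, killVars K S (A v) = A v)
    (hf : f - f₀ - ∑ v ∈ S, A v * X v ∈ varIdeal K (S : Set σ) ^ 2) (M w : σ → K)
    (h : ∀ τ : K, eval (fun v => if v ∈ S then w v * τ else M v) f = 0) :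
    eval M f₀ = 0 ∧ ∑ v ∈ S, eval M (A v) * w v = 0 := by
  let N : σ → Polynomial K := fun v =>
    if v ∈ S then Polynomial.C (w v) * Polynomial.X else Polynomial.C (M v)
  have hN : ∀ (g : MvPolynomial σ K) (τ : K), (aeval N g).eval τ =
      eval (fun v => if v ∈ S then w v * τ else M v) g := by
    intro g τ
    have : (Polynomial.aeval τ).comp (aeval N) =
        aeval (fun v => if v ∈ S then w v * τ else M v) := by
      ext v
      by_cases hv : v ∈ S <;> simp [N, hv]
    have := DFunLike.congr_fun this g
    simpa [aeval_eq_eval, Polynomial.aeval_def, Polynomial.eval₂_eq_eval_map] using this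
  have hfree : ∀ g : MvPolynomial σ K, killVars K S g = g → aeval N g = Polynomial.C (eval M g) := by
    intro g hg
    refine Polynomial.funext fun τ => ?_
    rw [hN, ← hg, eval_killVars, eval_killVars, Polynomial.eval_C]
    congr 2
    ext v
    by_cases hv : v ∈ S <;> simp [hv]
  have hf0 : aeval N f = 0 := Polynomial.funext fun τ => by rw [hN, h, Polynomial.eval_zero]
  have hsq : aeval N (f - f₀ - ∑ v ∈ S, A v * X v) ∈ Ideal.span {(Polynomial.X : Polynomial K)} ^ 2 := by
    have h1 : varIdeal K (S : Set σ) ≤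
        (Ideal.span {(Polynomial.X : Polynomial K)}).comap (aeval N) := by
      rw [varIdeal, Ideal.span_le]
      rintro _ ⟨v, hv, rfl⟩
      have hv' : v ∈ S := hv
      simp only [SetLike.mem_coe, Ideal.mem_comap, aeval_X, N, hv', if_true]
      exact Ideal.mul_mem_left _ _ (Ideal.mem_span_singleton_self _)
    exact (Ideal.pow_right_mono h1 2).trans (Ideal.le_comap_pow _ 2) hf
  have hsum : aeval N (∑ v ∈ S, A v * X v) =
      Polynomial.C (∑ v ∈ S, eval M (A v) * w v) * Polynomial.X := by
    rw [map_sum, map_sum, Finset.sum_mul]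
    refine Finset.sum_congr rfl fun v hv => ?_
    rw [map_mul, hfree _ (hA v), aeval_X, map_mul]
    simp only [N, hv, if_true]
    ring
  rw [map_sub, map_sub, hf0, hsum, hfree _ h₀, Ideal.span_singleton_pow,
    Ideal.mem_span_singleton, Polynomial.X_pow_dvd_iff] at hsq
  have c0 := hsq 0 (by norm_num)
  have c1 := hsq 1 (by norm_num)
  simp [Polynomial.coeff_C] at c0 c1
  exact ⟨c0, c1⟩

/-- Uniqueness of first order expansions. -/
lemma eq_zero_of_mem_sq [Infinite K] {S : Finset σ} {A : σ → MvPolynomial σ K}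
    {f₀ : MvPolynomial σ K} (h₀ : killVars K S f₀ = f₀)
    (hA : ∀ v, killVars K S (A v) = A v)
    (hf : f₀ + ∑ v ∈ S, A v * X v ∈ varIdeal K (S : Set σ) ^ 2) :
    f₀ = 0 ∧ ∀ v ∈ S, A v = 0 := by
  have key := fun M w => eval_eq_zero_of_line (f := 0) h₀ hA
    (by convert neg_mem hf using 1; ring) M w (by simp)
  refine ⟨MvPolynomial.funext fun M => by simpa using (key M 0).1, fun v hv => ?_⟩
  refine MvPolynomial.funext fun M => ?_
  have := (key M (Pi.single v 1)).2
  rw [Finset.sum_eq_single v (fun b _ hb => by simp [hb]) (fun h => absurd hv h)] at this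
  simpa using this

omit [DecidableEq σ] in
lemma eval_eq_zero_of_curve [Infinite K] (N : σ → Polynomial K) (f : MvPolynomial σ K)
    (h : ∀ τ : K, τ ≠ 0 → eval (fun v => (N v).eval τ) f = 0) :
    eval (fun v => (N v).eval 0) f = 0 := by
  have hN : ∀ (g : MvPolynomial σ K) (τ : K), (aeval N g).eval τ =
      eval (fun v => (N v).eval τ) g := by
    intro g τ
    have : (Polynomial.aeval τ).comp (aeval N) = aeval (fun v => (N v).eval τ) := by
      ext v
      simp
    have := DFunLike.congr_fun this g
    simpa [aeval_eq_eval, Polynomial.aeval_def, Polynomial.eval₂_eq_eval_map] using this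
  have h0 : Polynomial.X * aeval N f = 0 := by
    refine Polynomial.funext fun τ => ?_
    by_cases hτ : τ = 0
    · simp [hτ]
    · simp [hN, h τ hτ]
  have h1 : aeval N f = 0 := (mul_eq_zero.1 h0).resolve_left Polynomial.X_ne_zero
  rw [← hN, h1, Polynomial.eval_zero]

lemma eval_eq_zero_of_X_mul [Infinite K] (Z : Set (σ → K)) (v : σ)
    (hZ : ∀ M ∈ Z, ∀ τ, Function.update M v τ ∈ Z) (g : MvPolynomial σ K)
    (h : ∀ M ∈ Z, eval M (X v * g) = 0) : ∀ M ∈ Z, eval M g = 0 := by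
  intro M hM
  by_cases hv : M v = 0
  · have h1 : ∀ τ : K, (fun w => ((Function.update (fun w => Polynomial.C (M w)) v
        Polynomial.X : σ → Polynomial K) w).eval τ) = Function.update M v τ := by
      intro τ
      ext w
      by_cases hw : w = v
      · subst hw; simp
      · simp [hw]
    have := eval_eq_zero_of_curve (Function.update (fun w => Polynomial.C (M w)) v Polynomial.X) g
      (fun τ hτ => by
        rw [h1]
        have := h _ (hZ M hM τ)
        simpa [hτ] using this)
    rw [h1] at this
    have h2 : Function.update M v 0 = M := by rw [← hv, Function.update_eq_self]
    rwa [h2] at this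
  · have := h M hM
    simpa [hv] using this

/-- Polynomials vanishing on a coordinate subspace. -/
lemma mem_varIdeal_of_eval [Infinite K] (S : Finset σ) (f : MvPolynomial σ K)
    (h : ∀ M : σ → K, (∀ v ∈ S, M v = 0) → eval M f = 0) : f ∈ varIdeal K (S : Set σ) := by
  have h1 : killVars K S f = 0 := MvPolynomial.funext fun M => by
    rw [eval_killVars, map_zero]
    exact h _ fun v hv => by simp [hv]
  simpa [h1] using sub_killVars_mem S f

end KillVars

section VanishingIdeal

open MvPolynomial

variable {K : Type u} [Field K] {σ : Type}

/-- The ideal of polynomials vanishing on a set of points. -/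
def vanIdeal (Z : Set (σ → K)) : Ideal (MvPolynomial σ K) where
  carrier := {f | ∀ M ∈ Z, eval M f = 0}
  add_mem' := fun ha hb M hM => by simp [ha M hM, hb M hM]
  zero_mem' := fun M _ => by simp
  smul_mem' := fun c f hf M hM => by simp [hf M hM]

lemma mem_vanIdeal {Z : Set (σ → K)} {f : MvPolynomial σ K} :
    f ∈ vanIdeal Z ↔ ∀ M ∈ Z, eval M f = 0 := Iff.rfl

lemma vanIdeal_anti {Z Z' : Set (σ → K)} (h : Z' ⊆ Z) : vanIdeal Z ≤ vanIdeal Z' :=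
  fun _ hf M hM => hf M (h hM)

variable [DecidableEq σ]

lemma vanIdeal_sup_span_X (Z : Set (σ → K)) (v : σ)
    (hZ : ∀ M ∈ Z, Function.update M v 0 ∈ Z) :
    vanIdeal Z ⊔ Ideal.span {X v} = vanIdeal (Z ∩ {M | M v = 0}) := by
  refine le_antisymm (sup_le (vanIdeal_anti Set.inter_subset_left) ?_) fun f hf => ?_
  · rw [Ideal.span_singleton_le_iff_mem]
    intro M hM
    simpa using hM.2
  · have h1 := sub_killVars_mem {v} f
    have h2 : killVars K {v} f ∈ vanIdeal Z := by
      intro M hM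
      rw [eval_killVars]
      have : (fun w => if w ∈ ({v} : Finset σ) then 0 else M w) = Function.update M v 0 := by
        ext w
        by_cases hw : w = v
        · subst hw; simp
        · simp [hw]
      rw [this]
      exact hf _ ⟨hZ M hM, by simp⟩
    rw [Finset.coe_singleton, varIdeal, Set.image_singleton] at h1
    have := add_mem (Ideal.mem_sup_left h2 : _ ∈ vanIdeal Z ⊔ Ideal.span {X v})
      (Ideal.mem_sup_right h1)
    rwa [add_sub_cancel] at this

lemma X_mul_mem_vanIdeal [Infinite K] {Z : Set (σ → K)} {v : σ}
    (hZ : ∀ M ∈ Z, ∀ τ, Function.update M v τ ∈ Z) {g : MvPolynomial σ K}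
    (h : X v * g ∈ vanIdeal Z) : g ∈ vanIdeal Z :=
  eval_eq_zero_of_X_mul Z v hZ g h

lemma killVars_mem_varIdeal_sq {S T : Finset σ} {f : MvPolynomial σ K}
    (hf : f ∈ varIdeal K ((S ∪ T : Finset σ) : Set σ) ^ 2) :
    killVars K S f ∈ varIdeal K (T : Set σ) ^ 2 := by
  have h1 : varIdeal K ((S ∪ T : Finset σ) : Set σ) ≤
      (varIdeal K (T : Set σ)).comap (killVars K S) := by
    rw [varIdeal, Ideal.span_le]
    rintro _ ⟨v, hv, rfl⟩
    by_cases hvS : v ∈ S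
    · simp [killVars, hvS]
    · have hvT : v ∈ T := by
        have hv' : v ∈ S ∪ T := hv
        exact (Finset.mem_union.1 hv').resolve_left hvS
      rw [SetLike.mem_coe, Ideal.mem_comap, killVars_X_of_notMem hvS]
      exact X_mem_varIdeal hvT
  exact (Ideal.pow_right_mono h1 2).trans (Ideal.le_comap_pow _ 2) hf

lemma mem_varIdeal_sq_of_X_mul [Infinite K] {S : Finset σ} {c : σ} (hc : c ∉ S)
    {g : MvPolynomial σ K} (h : X c * g ∈ varIdeal K (S : Set σ) ^ 2) :
    g ∈ varIdeal K (S : Set σ) ^ 2 := by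
  obtain ⟨A, hA, hg⟩ := exists_first_order S g
  have key := eq_zero_of_mem_sq (S := S) (f₀ := X c * killVars K S g) (A := fun v => X c * A v)
    (by rw [map_mul, killVars_X_of_notMem hc, killVars_killVars])
    (fun v => by rw [map_mul, killVars_X_of_notMem hc, hA]) (by
      have := sub_mem h (Ideal.mul_mem_left _ (X c) hg)
      convert this using 1
      simp only [mul_sub, Finset.mul_sum, mul_assoc]
      ring)
  have h0 := (mul_eq_zero.1 key.1).resolve_left (X_ne_zero c)
  have h1 : ∑ v ∈ S, A v * X v = 0 := Finset.sum_eq_zero fun v hv => by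
    rw [(mul_eq_zero.1 (key.2 v hv)).resolve_left (X_ne_zero c), zero_mul]
  rwa [h0, h1, sub_zero, sub_zero] at hg

end VanishingIdeal

section RowPoints

open MvPolynomial

variable {K : Type u} [Field K] {σ ι : Type}

/-- The points for which some nonzero `v ∈ K²` is an eigenvector of the block in the first two rows
and is killed by the rows in `s`. The map `e` lists the coordinates row by row. -/
def rowPoints (e : (Fin 2 ⊕ ι) × Fin 2 ↪ σ) (s : Finset ι) : Set (σ → K) :=
  {M | ∃ p q : K, (p ≠ 0 ∨ q ≠ 0) ∧
    (M (e (.inl 0, 0)) * p + M (e (.inl 0, 1)) * q) * q =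
      (M (e (.inl 1, 0)) * p + M (e (.inl 1, 1)) * q) * p ∧
    ∀ j ∈ s, M (e (.inr j, 0)) * p + M (e (.inr j, 1)) * q = 0}

lemma rowPoints_anti (e : (Fin 2 ⊕ ι) × Fin 2 ↪ σ) {s t : Finset ι} (h : s ⊆ t) :
    (rowPoints e t : Set (σ → K)) ⊆ rowPoints e s := by
  rintro M ⟨p, q, h0, h1, h2⟩
  exact ⟨p, q, h0, h1, fun j hj => h2 j (h hj)⟩

lemma mem_rowPoints_of_root {e : (Fin 2 ⊕ ι) × Fin 2 ↪ σ} {s : Finset ι} {M : σ → K} (p : K)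
    (hp : M (e (.inl 1, 0)) * p ^ 2 + (M (e (.inl 1, 1)) - M (e (.inl 0, 0))) * p
      - M (e (.inl 0, 1)) = 0)
    (h : ∀ j ∈ s, M (e (.inr j, 0)) * p + M (e (.inr j, 1)) = 0) : M ∈ rowPoints e s :=
  ⟨p, 1, by simp, by linear_combination -hp, fun j hj => by rw [mul_one, h j hj]⟩

lemma mem_rowPoints_of_zero {e : (Fin 2 ⊕ ι) × Fin 2 ↪ σ} {s : Finset ι} {M : σ → K}
    (hc : M (e (.inl 1, 0)) = 0) (h : ∀ j ∈ s, M (e (.inr j, 0)) = 0) : M ∈ rowPoints e s :=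
  ⟨1, 0, by simp, by simp [hc], fun j hj => by simp [h j hj]⟩

lemma exists_quadratic_root [IsAlgClosed K] {c : K} (hc : c ≠ 0) (b d : K) :
    ∃ p, c * p ^ 2 + b * p + d = 0 := by
  obtain ⟨p, hp⟩ := IsAlgClosed.exists_root
    (Polynomial.C c * Polynomial.X ^ 2 + Polynomial.C b * Polynomial.X + Polynomial.C d)
    (by rw [Polynomial.degree_quadratic hc]; norm_num)
  exact ⟨p, by simpa using hp⟩

variable [IsAlgClosed K]

lemma vanIdeal_rowPoints_empty (e : (Fin 2 ⊕ ι) × Fin 2 ↪ σ) :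
    vanIdeal (rowPoints e ∅ : Set (σ → K)) = ⊥ := by
  rw [eq_bot_iff]
  intro f hf
  rw [Ideal.mem_bot]
  refine MvPolynomial.funext fun M => ?_
  rw [map_zero]
  refine hf M ?_
  by_cases hc : M (e (.inl 1, 0)) = 0
  · exact mem_rowPoints_of_zero hc (by simp)
  · obtain ⟨p, hp⟩ := exists_quadratic_root hc (M (e (.inl 1, 1)) - M (e (.inl 0, 0)))
      (-M (e (.inl 0, 1)))
    exact mem_rowPoints_of_root p (by linear_combination hp) (by simp)

/-- A relation that is linear in the roots of the generic quadratic equation is trivial. -/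
lemma eq_zero_of_forall_root (e : (Fin 2 ⊕ ι) × Fin 2 ↪ σ) {A B : MvPolynomial σ K}
    (h : ∀ (M : σ → K) (p : K), M (e (.inl 1, 0)) * p ^ 2 +
      (M (e (.inl 1, 1)) - M (e (.inl 0, 0))) * p - M (e (.inl 0, 1)) = 0 →
      eval M A = p * eval M B) : A = 0 ∧ B = 0 := by
  classical
  have hB : X (e (.inl 1, 0)) * ((X (e (.inl 0, 0)) - X (e (.inl 1, 1))) ^ 2 +
      4 * X (e (.inl 0, 1)) * X (e (.inl 1, 0))) * B = 0 := by
    refine MvPolynomial.funext fun M => ?_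
    simp only [map_mul, map_add, map_sub, map_pow, eval_X, map_zero, map_ofNat]
    by_cases hc : M (e (.inl 1, 0)) = 0
    · simp [hc]
    obtain ⟨p, hp⟩ := exists_quadratic_root hc (M (e (.inl 1, 1)) - M (e (.inl 0, 0)))
      (-M (e (.inl 0, 1)))
    obtain ⟨p', hp'⟩ : ∃ p', M (e (.inl 1, 0)) * p' =
        M (e (.inl 0, 0)) - M (e (.inl 1, 1)) - M (e (.inl 1, 0)) * p :=
      ⟨_, mul_div_cancel₀ _ hc⟩
    have h1 := h M p (by linear_combination hp)
    have h2 := h M p' (by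
      linear_combination hp + (p' - p) * hp')
    have h3 : (p - p') * eval M B = 0 := by linear_combination h2 - h1
    have h4 : (M (e (.inl 0, 0)) - M (e (.inl 1, 1))) ^ 2 +
        4 * M (e (.inl 0, 1)) * M (e (.inl 1, 0)) =
        M (e (.inl 1, 0)) * (M (e (.inl 1, 0)) * p -
          (M (e (.inl 0, 0)) - M (e (.inl 1, 1)) - M (e (.inl 1, 0)) * p)) * (p - p') := by
      linear_combination -4 * M (e (.inl 1, 0)) * hp + (M (e (.inl 1, 0)) * p -
          (M (e (.inl 0, 0)) - M (e (.inl 1, 1)) - M (e (.inl 1, 0)) * p)) * hp'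
    rw [h4]
    linear_combination M (e (.inl 1, 0)) * (M (e (.inl 1, 0)) * (M (e (.inl 1, 0)) * p -
          (M (e (.inl 0, 0)) - M (e (.inl 1, 1)) - M (e (.inl 1, 0)) * p))) * h3
  have hD : (X (e (.inl 0, 0)) - X (e (.inl 1, 1))) ^ 2 +
      4 * X (e (.inl 0, 1)) * X (e (.inl 1, 0)) ≠ (0 : MvPolynomial σ K) := by
    intro h0
    have := congrArg (eval (Pi.single (e (.inl 0, 0)) 1)) h0
    simp at this
  have hB0 : B = 0 := (mul_eq_zero.1 hB).resolve_left (mul_ne_zero (X_ne_zero _) hD)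
  refine ⟨?_, hB0⟩
  have hA : X (e (.inl 1, 0)) * A = 0 := by
    refine MvPolynomial.funext fun M => ?_
    rw [map_mul, eval_X, map_zero]
    by_cases hc : M (e (.inl 1, 0)) = 0
    · simp [hc]
    obtain ⟨p, hp⟩ := exists_quadratic_root hc (M (e (.inl 1, 1)) - M (e (.inl 0, 0)))
      (-M (e (.inl 0, 1)))
    rw [h M p (by linear_combination hp), hB0, map_zero, mul_zero, mul_zero]
  exact (mul_eq_zero.1 hA).resolve_left (X_ne_zero _)

variable [DecidableEq σ]

omit [IsAlgClosed K] in
lemma update_mem_rowPoints {e : (Fin 2 ⊕ ι) × Fin 2 ↪ σ} {s : Finset ι} {j₀ : ι} (hj : j₀ ∉ s)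
    (i : Fin 2) {M : σ → K} (hM : M ∈ rowPoints e s) (τ : K) :
    Function.update M (e (.inr j₀, i)) τ ∈ rowPoints e s := by
  obtain ⟨p, q, h0, h1, h2⟩ := hM
  refine ⟨p, q, h0, by simpa using h1, fun j hjs => ?_⟩
  have : j ≠ j₀ := by rintro rfl; exact hj hjs
  simpa [this] using h2 j hjs

lemma vanIdeal_rowPoints_le_sq (e : (Fin 2 ⊕ ι) × Fin 2 ↪ σ) (s : Finset ι) :
    vanIdeal (rowPoints e s : Set (σ → K)) ≤
      varIdeal K ((s.image (fun j => e (.inr j, 0)) ∪ s.image (fun j => e (.inr j, 1)) :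
        Finset σ) : Set σ) ^ 2 := by
  intro f hf
  set S := s.image (fun j => e (.inr j, 0)) ∪ s.image (fun j => e (.inr j, 1)) with hS
  have hinf : Infinite K := IsAlgClosed.instInfinite
  have hl : ∀ i i', e (.inl i, i') ∉ S := by simp [hS]
  have hx : ∀ j ∈ s, e (.inr j, 0) ∈ S := fun j hj => by simp [hS, hj]
  have hy : ∀ j ∈ s, e (.inr j, 1) ∈ S := fun j hj => by simp [hS, hj]
  obtain ⟨A, hA, hfA⟩ := exists_first_order S f
  have key := fun M w => eval_eq_zero_of_line (killVars_killVars S f) hA hfA M w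
  have h0 : killVars K S f = 0 := by
    refine (eq_zero_of_forall_root e (A := killVars K S f) (B := 0) fun M p hp => ?_).1
    rw [map_zero, mul_zero]
    refine (key M 0 fun τ => hf _ (mem_rowPoints_of_root p ?_ fun j hj => ?_)).1
    · simpa [hl] using hp
    · simp [hx j hj, hy j hj]
  have h1 : ∀ j ∈ s, A (e (.inr j, 0)) = 0 ∧ A (e (.inr j, 1)) = 0 := by
    intro j₀ hj₀
    refine eq_zero_of_forall_root e fun M p hp => ?_
    have := (key M (Pi.single (e (.inr j₀, 0)) 1 + Pi.single (e (.inr j₀, 1)) (-p))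
      fun τ => hf _ (mem_rowPoints_of_root p ?_ fun j hj => ?_)).2
    · simp only [Pi.add_apply, mul_add, Finset.sum_add_distrib] at this
      rw [Finset.sum_eq_single (e (.inr j₀, 0)) (fun b _ hb => by simp [hb])
        (fun h => absurd (hx _ hj₀) h), Finset.sum_eq_single (e (.inr j₀, 1))
        (fun b _ hb => by simp [hb]) (fun h => absurd (hy _ hj₀) h)] at this
      simp only [Pi.single_eq_same] at this
      linear_combination this
    · simpa [hl] using hp
    · by_cases hjj : j = j₀
      · subst hjj
        simp [hx j hj, hy j hj]
        ring
      · simp [hx j hj, hy j hj, hjj]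
  have h2 : ∑ v ∈ S, A v * X v = 0 := by
    refine Finset.sum_eq_zero fun v hv => ?_
    rw [hS, Finset.mem_union, Finset.mem_image, Finset.mem_image] at hv
    rcases hv with ⟨j, hj, rfl⟩ | ⟨j, hj, rfl⟩
    · rw [(h1 j hj).1, zero_mul]
    · rw [(h1 j hj).2, zero_mul]
  rwa [h0, h2, sub_zero, sub_zero] at hfA

end RowPoints

section RowIdeals

open MvPolynomial

variable {K : Type u} [Field K] [IsAlgClosed K] {σ ι : Type} [DecidableEq σ]

lemma mem_vanIdeal_of_X_mul (e : (Fin 2 ⊕ ι) × Fin 2 ↪ σ) {s : Finset ι} {j₀ : ι} (hj₀ : j₀ ∈ s)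
    {g : MvPolynomial σ K} (hg : X (e (.inr j₀, 0)) * g ∈ vanIdeal (rowPoints e s : Set (σ → K))) :
    g ∈ vanIdeal (rowPoints e s : Set (σ → K)) := by
  have hinf : Infinite K := IsAlgClosed.instInfinite
  have hg0 : ∀ M ∈ rowPoints e s, M (e (.inr j₀, 0)) ≠ 0 → eval M g = 0 := by
    intro M hM h
    have := hg M hM
    rw [map_mul, eval_X] at this
    exact (mul_eq_zero.1 this).resolve_left h
  have main : ∀ M : σ → K, M (e (.inl 1, 0)) = 0 → (∀ j ∈ s, M (e (.inr j, 0)) = 0) →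
      M (e (.inr j₀, 1)) ≠ 0 → eval M g = 0 := by
    intro M hc hx hy
    let f : σ → σ := Function.extend (fun j => e (.inr j, 0)) (fun j => e (.inr j, 1)) id
    have hf : ∀ j, f (e (.inr j, 0)) = e (.inr j, 1) := fun j => by
      have hi : Function.Injective (fun j => e (.inr j, 0)) := fun i j h => by simpa using h
      exact hi.extend_apply _ _ j
    let S := s.image (fun j => e (.inr j, 0))
    have hS : ∀ j ∈ s, e (.inr j, 0) ∈ S := fun j hj => by simp [S, hj]
    have hl : ∀ i i', e (.inl i, i') ∉ S := by simp [S]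
    have hy' : ∀ i, e (.inr i, 1) ∉ S := by simp [S]
    let N : σ → Polynomial K := fun v => if v = e (.inl 1, 0) then
        Polynomial.C (M (e (.inl 0, 0)) - M (e (.inl 1, 1))) * Polynomial.X +
          Polynomial.C (M (e (.inl 0, 1))) * Polynomial.X ^ 2
      else if v ∈ S then - Polynomial.C (M (f v)) * Polynomial.X else Polynomial.C (M v)
    have h0 : (fun v => (N v).eval 0) = M := by
      ext v
      by_cases h1 : v = e (.inl 1, 0)
      · simp [N, h1, hc]
      · by_cases h2 : v ∈ S
        · obtain ⟨j, hj, rfl⟩ := Finset.mem_image.1 h2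
          simp [N, hS j hj, hx j hj]
        · simp [N, h1, h2]
    rw [← h0]
    refine eval_eq_zero_of_curve N g fun τ hτ => hg0 _ ⟨1, τ, by simp, ?_, fun j hj => ?_⟩ ?_
    · simp [N, hl]
      ring
    · simp [N, hS j hj, hf, hy']
    · simp [N, hS j₀ hj₀, hf, hτ, hy]
  intro M hM
  obtain ⟨p, q, hpq, h1, h2⟩ := hM
  by_cases hx₀ : M (e (.inr j₀, 0)) = 0
  swap
  · exact hg0 M ⟨p, q, hpq, h1, h2⟩ hx₀
  by_cases hq : q = 0
  · subst hq
    have hp : p ≠ 0 := by simpa using hpq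
    have hc : M (e (.inl 1, 0)) = 0 := by simpa [hp] using h1
    have hx : ∀ j ∈ s, M (e (.inr j, 0)) = 0 := fun j hj => by simpa [hp] using h2 j hj
    by_cases hy : M (e (.inr j₀, 1)) = 0
    swap
    · exact main M hc hx hy
    have h0 : ∀ τ : K, (fun w => ((Function.update (fun w => Polynomial.C (M w)) (e (.inr j₀, 1))
        Polynomial.X : σ → Polynomial K) w).eval τ) = Function.update M (e (.inr j₀, 1)) τ := by
      intro τ
      ext w
      by_cases hw : w = e (.inr j₀, 1)
      · subst hw; simp
      · simp [hw]
    have := eval_eq_zero_of_curve (Function.update (fun w => Polynomial.C (M w)) (e (.inr j₀, 1))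
        Polynomial.X) g (fun τ hτ => by
        rw [h0]
        refine main _ (by simpa using hc) (fun j hj => by simpa using hx j hj) (by simpa using hτ))
    rw [h0] at this
    have h3 : Function.update M (e (.inr j₀, 1)) 0 = M := by rw [← hy, Function.update_eq_self]
    rwa [h3] at this
  · have hy₀ : M (e (.inr j₀, 1)) = 0 := by simpa [hx₀, hq] using h2 j₀ hj₀
    let N : σ → Polynomial K := fun v => if v = e (.inr j₀, 0) then
        Polynomial.C q * Polynomial.X else if v = e (.inr j₀, 1) then
        - Polynomial.C p * Polynomial.X else Polynomial.C (M v)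
    have h0 : (fun v => (N v).eval 0) = M := by
      ext v
      by_cases h1 : v = e (.inr j₀, 0)
      · simp [N, h1, hx₀]
      · by_cases h2 : v = e (.inr j₀, 1)
        · simp [N, h2, hy₀]
        · simp [N, h1, h2]
    rw [← h0]
    refine eval_eq_zero_of_curve N g fun τ hτ => hg0 _ ⟨p, q, hpq, ?_, fun j hj => ?_⟩ ?_
    · simpa [N] using h1
    · by_cases hjj : j = j₀
      · subst hjj
        simp [N]
        ring
      · simpa [N, hjj] using h2 j hj
    · simp [N, hτ, hq]

lemma X_mul_mem_iff_mem_jIdeal (e : (Fin 2 ⊕ ι) × Fin 2 ↪ σ) {s : Finset ι} {j₀ : ι}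
    (hj₀ : j₀ ∈ s) (g : MvPolynomial σ K) :
    X (e (.inr j₀, 1)) * g ∈ vanIdeal (rowPoints e s : Set (σ → K)) ⊔
        Ideal.span {X (e (.inr j₀, 0))} ↔
      g ∈ varIdeal K ((s.image (fun j => e (.inr j, 0)) : Finset σ) : Set σ) ⊔
        Ideal.span {X (e (.inl 1, 0))} *
          varIdeal K ((s.image (fun j => e (.inr j, 1)) : Finset σ) : Set σ) := by
  have hinf : Infinite K := IsAlgClosed.instInfinite
  set V := vanIdeal (rowPoints e s : Set (σ → K)) with hV
  set x := s.image (fun j => e (.inr j, 0)) with hx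
  set y := s.image (fun j => e (.inr j, 1)) with hy
  set J := varIdeal K (x : Set σ) ⊔ Ideal.span {X (e (.inl 1, 0))} * varIdeal K (y : Set σ) with hJ
  have back : ∀ g ∈ J, X (e (.inr j₀, 1)) * g ∈ V ⊔ Ideal.span {X (e (.inr j₀, 0))} := by
    have hle : J ≤ Submodule.comap (LinearMap.mulLeft (MvPolynomial σ K) (X (e (.inr j₀, 1))))
        (V ⊔ Ideal.span {X (e (.inr j₀, 0))}) := by
      have hx₀ : ∀ f : MvPolynomial σ K,
          X (e (.inr j₀, 0)) * f ∈ V ⊔ Ideal.span {X (e (.inr j₀, 0))} := fun f =>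
        Ideal.mem_sup_right (Ideal.mul_mem_right _ _ (Ideal.mem_span_singleton_self _))
      refine sup_le ?_ (Ideal.mul_le.2 fun f hf w hw => ?_)
      · rw [varIdeal, Ideal.span_le]
        rintro _ ⟨_, hv, rfl⟩
        obtain ⟨j, hj, rfl⟩ := Finset.mem_image.1 (Finset.mem_coe.1 hv)
        rw [SetLike.mem_coe, Submodule.mem_comap, LinearMap.mulLeft_apply]
        have h1 : X (e (.inr j₀, 1)) * X (e (.inr j, 0)) -
            X (e (.inr j₀, 0)) * X (e (.inr j, 1)) ∈ V := by
          rintro M ⟨p, q, hpq, -, h⟩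
          simp only [map_mul, map_sub, eval_X]
          have h1 := h j hj
          have h2 := h j₀ hj₀
          rcases hpq with hp | hq
          · refine (mul_eq_zero.1 (?_ : p * _ = 0)).resolve_left hp
            linear_combination M (e (.inr j₀, 1)) * h1 - M (e (.inr j, 1)) * h2
          · refine (mul_eq_zero.1 (?_ : q * _ = 0)).resolve_left hq
            linear_combination M (e (.inr j, 0)) * h2 - M (e (.inr j₀, 0)) * h1
        have := add_mem (Ideal.mem_sup_left h1) (hx₀ (X (e (.inr j, 1))))
        rwa [sub_add_cancel] at this
      · obtain ⟨f, rfl⟩ := Ideal.mem_span_singleton'.1 hf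
        rw [mul_assoc]
        refine Ideal.mul_mem_left _ f ?_
        have hle : varIdeal K (y : Set σ) ≤ Submodule.comap (LinearMap.mulLeft (MvPolynomial σ K)
            (X (e (.inr j₀, 1)) * X (e (.inl 1, 0)))) (V ⊔ Ideal.span {X (e (.inr j₀, 0))}) := by
          rw [varIdeal, Ideal.span_le]
          rintro _ ⟨_, hv, rfl⟩
          obtain ⟨j, hj, rfl⟩ := Finset.mem_image.1 (Finset.mem_coe.1 hv)
          rw [SetLike.mem_coe, Submodule.mem_comap, LinearMap.mulLeft_apply]
          have h1 : X (e (.inr j₀, 1)) * X (e (.inl 1, 0)) * X (e (.inr j, 1)) -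
              X (e (.inr j₀, 0)) * (X (e (.inl 0, 1)) * X (e (.inr j, 0)) -
                (X (e (.inl 0, 0)) - X (e (.inl 1, 1))) * X (e (.inr j, 1))) ∈ V := by
            rintro M ⟨p, q, hpq, h0, h⟩
            simp only [map_mul, map_sub, eval_X]
            have h1 := h j hj
            have h2 := h j₀ hj₀
            by_cases hq : q = 0
            · subst hq
              have hp : p ≠ 0 := by simpa using hpq
              have hc : M (e (.inl 1, 0)) = 0 := by simpa [hp] using h0
              have hx : M (e (.inr j, 0)) = 0 := by simpa [hp] using h1
              have hx' : M (e (.inr j₀, 0)) = 0 := by simpa [hp] using h2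
              simp [hc, hx']
            · refine (mul_eq_zero.1 (?_ : q ^ 2 * _ = 0)).resolve_left (pow_ne_zero 2 hq)
              linear_combination M (e (.inl 1, 0)) * (M (e (.inr j, 1)) * q * h2 -
                M (e (.inr j₀, 0)) * p * h1) + (M (e (.inl 0, 0)) - M (e (.inl 1, 1))) *
                M (e (.inr j₀, 0)) * q * h1 - M (e (.inr j₀, 0)) * M (e (.inr j, 0)) * h0
          have := add_mem (Ideal.mem_sup_left h1) (hx₀ (X (e (.inl 0, 1)) * X (e (.inr j, 0)) -
                (X (e (.inl 0, 0)) - X (e (.inl 1, 1))) * X (e (.inr j, 1))))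
          rwa [sub_add_cancel] at this
        have := hle hw
        rwa [Submodule.mem_comap, LinearMap.mulLeft_apply, mul_assoc] at this
    intro g hg
    exact hle hg
  refine ⟨fun hg => ?_, back g⟩
  have hx₀ : e (.inr j₀, 0) ∈ x ∪ y := by simp [hx, hj₀]
  have hy₀ : e (.inr j₀, 1) ∈ x ∪ y := by simp [hy, hj₀]
  have hc : e (.inl 1, 0) ∉ x ∪ y := by simp [hx, hy]
  have h1 : g ∈ varIdeal K ((insert (e (.inl 1, 0)) x : Finset σ) : Set σ) := by
    refine mem_varIdeal_of_eval _ g fun M hM => ?_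
    refine X_mul_mem_vanIdeal (Z := {M | ∀ v ∈ insert (e (.inl 1, 0)) x, M v = 0})
      (v := e (.inr j₀, 1)) (fun M hM τ v hv => ?_) (fun M hM => ?_) M hM
    · have : v ≠ e (.inr j₀, 1) := by
        rintro rfl
        simp [hx] at hv
      rw [Function.update_of_ne this]
      exact hM v hv
    · have hM' : M ∈ rowPoints e s ∩ {M | M (e (.inr j₀, 0)) = 0} :=
        ⟨mem_rowPoints_of_zero (hM _ (by simp)) fun j hj => hM _ (by simp [hx, hj]),
          hM _ (by simp [hx, hj₀])⟩
      have hle : V ⊔ Ideal.span {X (e (.inr j₀, 0))} ≤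
          vanIdeal (rowPoints e s ∩ {M | M (e (.inr j₀, 0)) = 0} : Set (σ → K)) := by
        refine sup_le (vanIdeal_anti Set.inter_subset_left) ?_
        rw [Ideal.span_singleton_le_iff_mem]
        intro M hM
        simpa using hM.2
      exact hle hg M hM'
  rw [Finset.coe_insert, varIdeal_insert] at h1
  obtain ⟨g₁, hg₁, g₂, hg₂, rfl⟩ := Submodule.mem_sup.1 h1
  obtain ⟨h, rfl⟩ := Ideal.mem_span_singleton'.1 hg₂
  obtain ⟨k, hk, hkk⟩ : ∃ k, killVars K (x ∪ y) k = k ∧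
      (g₁ + h * X (e (.inl 1, 0))) - X (e (.inl 1, 0)) * k ∈ J := by
    refine ⟨killVars K (x ∪ y) h, killVars_killVars _ _, ?_⟩
    have h2 := sub_killVars_mem (x ∪ y) h
    rw [Finset.coe_union, varIdeal_union] at h2
    obtain ⟨a, ha, b, hb, hab⟩ := Submodule.mem_sup.1 h2
    have : g₁ + h * X (e (.inl 1, 0)) - X (e (.inl 1, 0)) * killVars K (x ∪ y) h =
        (g₁ + X (e (.inl 1, 0)) * a) + X (e (.inl 1, 0)) * b := by
      linear_combination -X (e (.inl 1, 0)) * hab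
    rw [this]
    exact add_mem (Ideal.mem_sup_left (add_mem hg₁ (Ideal.mul_mem_left _ _ ha)))
      (Ideal.mem_sup_right (Ideal.mul_mem_mul (Ideal.mem_span_singleton_self _) hb))
  have h3 := sub_mem hg (back _ hkk)
  rw [← mul_sub, sub_sub_cancel] at h3
  obtain ⟨v, hv, w, hw, hvw⟩ := Submodule.mem_sup.1 h3
  obtain ⟨z, rfl⟩ := Ideal.mem_span_singleton'.1 hw
  have h4 := vanIdeal_rowPoints_le_sq e s hv
  have hne : e (.inr j₀, 0) ≠ e (.inr j₀, 1) := by simp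
  have h5 := (eq_zero_of_mem_sq (S := x ∪ y) (f₀ := 0)
    (A := Pi.single (e (.inr j₀, 1)) (X (e (.inl 1, 0)) * k) +
      Pi.single (e (.inr j₀, 0)) (-killVars K (x ∪ y) z)) (map_zero _) (fun v => by
        rw [Pi.add_apply, map_add, Pi.single_apply, Pi.single_apply]
        congr 1
        · split_ifs
          · rw [map_mul, hk, killVars_X_of_notMem hc]
          · rw [map_zero]
        · split_ifs
          · rw [map_neg, killVars_killVars]
          · rw [map_zero]) (by
      simp only [Pi.add_apply, add_mul, Finset.sum_add_distrib, zero_add]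
      rw [Finset.sum_eq_single (e (.inr j₀, 1)) (fun b _ hb => by simp [hb])
        (fun h => absurd hy₀ h), Finset.sum_eq_single (e (.inr j₀, 0))
        (fun b _ hb => by simp [hb]) (fun h => absurd hx₀ h), Pi.single_eq_same,
        Pi.single_eq_same]
      have h6 := Ideal.mul_mem_mul (sub_killVars_mem (x ∪ y) z)
        (X_mem_varIdeal (K := K) (Finset.mem_coe.2 hx₀))
      rw [← pow_two] at h6
      convert add_mem h4 h6 using 1
      linear_combination -hvw)).2 _ hy₀
  rw [Pi.add_apply, Pi.single_eq_same, Pi.single_eq_of_ne hne.symm, add_zero] at h5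
  rwa [h5, sub_zero] at hkk

end RowIdeals

section RowInduction

open MvPolynomial

variable {K : Type u} [Field K] [IsAlgClosed K] {σ ι : Type} [DecidableEq σ]

lemma vanIdeal_rowPoints_le (e : (Fin 2 ⊕ ι) × Fin 2 ↪ σ) (s : Finset ι) :
    vanIdeal (rowPoints e s : Set (σ → K)) ≤
      varIdeal K ((s.image (fun j => e (.inr j, 0)) : Finset σ) : Set σ) ⊔
        Ideal.span {X (e (.inl 1, 0))} *
          varIdeal K ((s.image (fun j => e (.inr j, 1)) : Finset σ) : Set σ) ^ 2 := by
  intro f hf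
  have hinf : Infinite K := IsAlgClosed.instInfinite
  set x := s.image (fun j => e (.inr j, 0)) with hx
  set y := s.image (fun j => e (.inr j, 1)) with hy
  have hc : e (.inl 1, 0) ∉ y := by simp [hy]
  have h1 := killVars_mem_varIdeal_sq (vanIdeal_rowPoints_le_sq e s hf)
  have h2 : killVars K x f ∈ varIdeal K (({e (.inl 1, 0)} : Finset σ) : Set σ) := by
    refine mem_varIdeal_of_eval _ _ fun M hM => ?_
    rw [eval_killVars]
    refine hf _ (mem_rowPoints_of_zero ?_ fun j hj => ?_)
    · simp [hM]
    · rw [if_pos (by simp [hx, hj])]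
  rw [Finset.coe_singleton, varIdeal, Set.image_singleton] at h2
  obtain ⟨g, hg⟩ := Ideal.mem_span_singleton'.1 h2
  rw [← hg, mul_comm] at h1
  have h3 := mem_varIdeal_sq_of_X_mul hc h1
  have h4 := add_mem (Ideal.mem_sup_left (sub_killVars_mem x f))
    (Ideal.mem_sup_right (Ideal.mul_mem_mul
      (Ideal.mem_span_singleton_self (X (e (.inl 1, 0)) : MvPolynomial σ K)) h3))
  rw [← hg, mul_comm g, sub_add_cancel] at h4
  exact h4

variable [DecidableEq ι]
variable {P : ChainComplex (ModuleCat.{u} (MvPolynomial σ K)) ℕ} [∀ i, Projective (P.X i)]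

theorem exists_tLen_vanIdeal (hk : Kills P (Ideal.span (Set.range (X : σ → MvPolynomial σ K))))
    (h0 : tLen P 0 (MvPolynomial σ K) = 1) (hs : ∀ i, tLen P (i + 1) (MvPolynomial σ K) = 0)
    (e : (Fin 2 ⊕ ι) × Fin 2 ↪ σ) (s : Finset ι) :
    ∃ t : ℕ → ℕ, (∀ i, tLen P i (MvPolynomial σ K ⧸ vanIdeal (rowPoints e s : Set (σ → K))) = t i) ∧
      ∀ i, t i + 2 * s.card.choose (i + 1) = (2 * s.card).choose (i + 1) + Nat.choose 0 i := by
  have hinf : Infinite K := IsAlgClosed.instInfinite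
  induction s using Finset.induction_on with
  | empty =>
    refine ⟨fun i => Nat.choose 0 i, fun i => ?_, fun i => by simp⟩
    rw [vanIdeal_rowPoints_empty, tLen_congr (AlgEquiv.quotientBot (MvPolynomial σ K)
      (MvPolynomial σ K)).toLinearEquiv]
    cases i with
    | zero => simpa using h0
    | succ i => simpa using hs i
  | insert j₀ s hj₀ ih =>
    obtain ⟨b, hb, hbr⟩ := ih
    rw [Finset.card_insert_of_notMem hj₀]
    set x := (insert j₀ s).image (fun j => e (.inr j, 0)) with hx
    set y := (insert j₀ s).image (fun j => e (.inr j, 1)) with hy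
    have hanti := rowPoints_anti (K := K) e (Finset.subset_insert j₀ s)
    have hVV := vanIdeal_anti hanti
    have hX : ∀ M ∈ (rowPoints e s : Set (σ → K)), ∀ i τ,
        Function.update M (e (.inr j₀, i)) τ ∈ rowPoints e s :=
      fun M hM i τ => update_mem_rowPoints hj₀ i hM τ
    have hI := vanIdeal_sup_span_X (rowPoints e s : Set (σ → K)) (e (.inr j₀, 0))
      fun M hM => hX M hM _ _
    have hY : ∀ M ∈ (rowPoints e s ∩ {M | M (e (.inr j₀, 0)) = 0} : Set (σ → K)), ∀ τ,
        Function.update M (e (.inr j₀, 1)) τ ∈ rowPoints e s ∩ {M | M (e (.inr j₀, 0)) = 0} :=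
      fun M hM τ => ⟨hX M hM.1 _ _, by simpa using hM.2⟩
    have hU := vanIdeal_sup_span_X (rowPoints e s ∩ {M | M (e (.inr j₀, 0)) = 0} : Set (σ → K))
      (e (.inr j₀, 1)) fun M hM => hY M hM _
    have hle : vanIdeal (rowPoints e (insert j₀ s) : Set (σ → K)) ≤
        vanIdeal (rowPoints e s) ⊔ Ideal.span {X (e (.inr j₀, 0))} ⊔
          Ideal.span {X (e (.inr j₀, 1))} := by
      rw [hI, hU]
      refine vanIdeal_anti ?_
      rintro M ⟨⟨⟨p, q, hpq, h, h'⟩, hM₀⟩, hM₁⟩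
      refine ⟨p, q, hpq, h, fun j hj => ?_⟩
      rcases Finset.mem_insert.1 hj with rfl | hj
      · rw [hM₀, hM₁, zero_mul, zero_mul, add_zero]
      · exact h' j hj
    refine exists_tLen_step hk h0 hs (x := x) (y := y) (c := e (.inl 1, 0)) (x₀ := e (.inr j₀, 0))
      (y₀ := e (.inr j₀, 1)) (V := vanIdeal (rowPoints e s)) ?_ ?_ ?_ ?_ ?_ rfl rfl rfl rfl
      ?_ hVV ?_ ?_ ?_ ?_ ?_ ?_ hb hbr
    · rw [Finset.disjoint_left, hx, hy]
      simp
    · simp [hx]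
    · simp [hx]
    · rw [hx, Finset.card_image_of_injective _ fun i j h => by simpa using h,
        Finset.card_insert_of_notMem hj₀]
    · rw [hy, Finset.card_image_of_injective _ fun i j h => by simpa using h,
        Finset.card_insert_of_notMem hj₀]
    · refine le_antisymm (sup_le_sup_right (sup_le_sup_right hVV _) _)
        (sup_le (sup_le hle ?_) le_sup_right)
      exact le_sup_right.trans le_sup_left
    · exact fun g hg => X_mul_mem_vanIdeal (fun M hM => hX M hM _) hg
    · exact fun g hg => mem_vanIdeal_of_X_mul e (Finset.mem_insert_self j₀ s) hg
    · rw [hI]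
      exact fun g hg => X_mul_mem_vanIdeal hY hg
    · exact fun g => X_mul_mem_iff_mem_jIdeal e (Finset.mem_insert_self j₀ s) g
    · refine sup_le (hVV.trans (vanIdeal_rowPoints_le e _)) ?_
      rw [Ideal.span_singleton_le_iff_mem]
      exact Ideal.mem_sup_left (X_mem_varIdeal (Finset.mem_coe.2 (by simp [hx])))
    · intro v _
      have h1 := varIdeal_sup_sq_le (K := K) {e (.inr j₀, 0)} (x.erase (e (.inr j₀, 0)) ∪ y) v
      rw [Finset.coe_singleton] at h1
      refine le_trans (sup_le ?_ ?_) h1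
      · rw [Ideal.span_singleton_one, Ideal.top_mul]
        refine le_trans ((vanIdeal_rowPoints_le_sq e s).trans
          (Ideal.pow_right_mono (varIdeal_mono ?_) 2)) le_sup_right
        rw [Finset.coe_subset]
        intro w hw
        rcases Finset.mem_union.1 hw with hw | hw
        · obtain ⟨j, hj, rfl⟩ := Finset.mem_image.1 hw
          have : j ≠ j₀ := by rintro rfl; exact hj₀ hj
          simp [hx, this, hj]
        · obtain ⟨j, hj, rfl⟩ := Finset.mem_image.1 hw
          simp [hy, hj]
      · rw [Ideal.span_singleton_le_iff_mem]
        exact Ideal.mem_sup_left (X_mem_varIdeal (Set.mem_singleton _))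

end RowInduction

end BettiComputation

section BettiNumbers

open MvPolynomial

variable {K : Type u} [Field K]

lemma kalmanIdeal_eq_vanIdeal (r : ℕ) (e : (Fin 2 ⊕ Fin r) × Fin 2 ↪ Fin (2 + r) × Fin (2 + r))
    (he : ∀ i j, e (i, j) = (finSumFinEquiv i, Fin.castAdd r j)) :
    kalmanIdeal K (2 + r) 2 1 = vanIdeal (rowPoints e Finset.univ) := by
  have hmul : ∀ (M : Matrix (Fin (2 + r)) (Fin (2 + r)) K) (v : Fin (2 + r) → K),
      v ∈ firstCoordsSubspace K (2 + r) 2 → ∀ i, M.mulVec v (finSumFinEquiv i) =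
        M (e (i, 0)).1 (e (i, 0)).2 * v (Fin.castAdd r 0) +
          M (e (i, 1)).1 (e (i, 1)).2 * v (Fin.castAdd r 1) := by
    intro M v hv i
    rw [Matrix.mulVec, dotProduct, Fin.sum_univ_add, Fin.sum_univ_two, he, he,
      Finset.sum_eq_zero, add_zero]
    intro j _
    rw [hv _ (by simp), mul_zero]
  have h : ∀ M : Matrix (Fin (2 + r)) (Fin (2 + r)) K, M ∈ kalmanSet K (2 + r) 2 1 ↔
      (fun p => M p.1 p.2) ∈ rowPoints e Finset.univ := by
    intro M
    constructor
    · rintro ⟨U, hU, hU1, hUM⟩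
      obtain ⟨⟨v, hvU⟩, hv0, hv⟩ := finrank_eq_one_iff'.1 hU1
      obtain ⟨l, hl⟩ := hv ⟨_, hUM v hvU⟩
      have hl' : l • v = M.mulVec v := congrArg Subtype.val hl
      have hm := hmul M v (hU hvU)
      simp only [← hl', Pi.smul_apply, smul_eq_mul] at hm
      refine ⟨v (Fin.castAdd r 0), v (Fin.castAdd r 1), ?_, ?_, fun j _ => ?_⟩
      · by_contra! hc
        refine hv0 (Subtype.ext (funext fun i => ?_))
        refine Fin.addCases (fun i => ?_) (fun i => ?_) i
        · fin_cases i
          · exact hc.1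
          · exact hc.2
        · exact hU hvU _ (by simp)
      · have h0 := hm (.inl 0)
        have h1 := hm (.inl 1)
        rw [finSumFinEquiv_apply_left] at h0 h1
        rw [← h0, ← h1]
        ring
      · rw [← hm (.inr j), finSumFinEquiv_apply_right, hU hvU _ (by simp), mul_zero]
    · rintro ⟨p, q, hpq, h0, h1⟩
      let v : Fin (2 + r) → K := Fin.append ![p, q] 0
      have hv0 : v (Fin.castAdd r 0) = p := by simp [v]
      have hv1 : v (Fin.castAdd r 1) = q := by simp [v]
      have hvr : ∀ j, v (Fin.natAdd 2 j) = 0 := by simp [v]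
      have hvL : v ∈ firstCoordsSubspace K (2 + r) 2 := by
        intro i hi
        revert hi
        refine Fin.addCases (fun i hi => ?_) (fun i _ => hvr i) i
        have := i.2
        simp at hi
        omega
      have hv : v ≠ 0 := by
        intro hv
        rcases hpq with hp | hq
        · exact hp (by rw [← hv0, hv, Pi.zero_apply])
        · exact hq (by rw [← hv1, hv, Pi.zero_apply])
      have hm := hmul M v hvL
      rw [hv0, hv1] at hm
      obtain ⟨l, hl0, hl1⟩ : ∃ l, l * p = M (e (.inl 0, 0)).1 (e (.inl 0, 0)).2 * p +
            M (e (.inl 0, 1)).1 (e (.inl 0, 1)).2 * q ∧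
          l * q = M (e (.inl 1, 0)).1 (e (.inl 1, 0)).2 * p +
            M (e (.inl 1, 1)).1 (e (.inl 1, 1)).2 * q := by
        rcases hpq with hp | hq
        · refine ⟨_, div_mul_cancel₀ _ hp, ?_⟩
          rw [div_mul_eq_mul_div, h0, mul_div_cancel_right₀ _ hp]
        · refine ⟨_, ?_, div_mul_cancel₀ _ hq⟩
          rw [div_mul_eq_mul_div, ← h0, mul_div_cancel_right₀ _ hq]
      have hMv : M.mulVec v = l • v := by
        ext i
        refine Fin.addCases (fun i => ?_) (fun i => ?_) i
        · rw [← finSumFinEquiv_apply_left, hm, finSumFinEquiv_apply_left, Pi.smul_apply,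
            smul_eq_mul]
          fin_cases i
          · exact hl0.symm.trans (by rw [← hv0]; rfl)
          · exact hl1.symm.trans (by rw [← hv1]; rfl)
        · rw [← finSumFinEquiv_apply_right, hm, finSumFinEquiv_apply_right, Pi.smul_apply,
            smul_eq_mul, hvr, mul_zero]
          exact h1 i (Finset.mem_univ i)
      refine ⟨K ∙ v, ?_, finrank_span_singleton hv, fun w hw => ?_⟩
      · rwa [Submodule.span_singleton_le_iff_mem]
      · obtain ⟨k, rfl⟩ := Submodule.mem_span_singleton.1 hw
        rw [Matrix.mulVec_smul, hMv]
        exact Submodule.smul_mem _ _ (Submodule.smul_mem _ _ (Submodule.mem_span_singleton_self v))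
  ext f
  constructor
  · intro hf M hM
    exact hf (fun i j => M (i, j)) ((h _).2 hM)
  · intro hf M hM
    exact hf _ ((h _).1 hM)

lemma sub_C_mem_irrelevantIdeal {n : ℕ} (f : MatCoordRing K n) :
    f - C (constantCoeff f) ∈ irrelevantIdeal K n := by
  have h1 := sub_killVars_mem Finset.univ f
  have h2 : killVars K (Finset.univ : Finset (Fin n × Fin n)) f = C (constantCoeff f) := by
    have : killVars K (Finset.univ : Finset (Fin n × Fin n)) =
        (Algebra.ofId K (MatCoordRing K n)).comp (aeval (fun _ => (0 : K))) := by
      ext v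
      simp [killVars]
    rw [this, AlgHom.comp_apply, Algebra.ofId_apply, algebraMap_eq]
    congr 1
    exact aeval_zero' f
  rw [h2, Finset.coe_univ, varIdeal, Set.image_univ] at h1
  exact h1

instance irrelevantIdeal_isMaximal (n : ℕ) : (irrelevantIdeal K n).IsMaximal := by
  have : irrelevantIdeal K n = RingHom.ker (constantCoeff (R := K) (σ := Fin n × Fin n)) := by
    refine le_antisymm ?_ fun f hf => ?_
    · rw [irrelevantIdeal, Ideal.span_le]
      rintro _ ⟨v, rfl⟩
      simp
    · have := sub_C_mem_irrelevantIdeal f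
      rwa [(RingHom.mem_ker).1 hf, C_0, sub_zero] at this
  rw [this]
  exact RingHom.ker_isMaximal_of_surjective _ fun k => ⟨C k, constantCoeff_C _ k⟩

/-- Over `A`, a module killed by the irrelevant ideal has length equal to its dimension. -/
lemma finrank_eq_length_toNat {n : ℕ} (W : Type u) [AddCommGroup W] [Module (MatCoordRing K n) W]
    (hW : ∀ f ∈ irrelevantIdeal K n, ∀ w : W, f • w = 0) :
    @Module.finrank K W _ _ (Module.compHom W (algebraMap K (MatCoordRing K n))) =
      (Module.length (MatCoordRing K n) W).toNat := by
  let _ : Module K W := Module.compHom W (algebraMap K (MatCoordRing K n))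
  let _ : Algebra (MatCoordRing K n) K := (constantCoeff (R := K) (σ := Fin n × Fin n)).toAlgebra
  have : IsScalarTower (MatCoordRing K n) K W := by
    refine IsScalarTower.of_algebraMap_smul fun f w => ?_
    have h1 := hW _ (sub_C_mem_irrelevantIdeal f) w
    rw [sub_smul, sub_eq_zero] at h1
    exact h1.symm
  have h := Module.length_eq_of_surjective (S := MatCoordRing K n) (R := K) (M := W)
    fun k => ⟨C k, constantCoeff_C _ k⟩
  rw [h, Module.length_eq_rank, Cardinal.toNat_toENat, Module.finrank]

variable [IsAlgClosed K]

theorem exists_length_kalmanTorModule (r : ℕ) :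
    ∃ t : ℕ → ℕ, (∀ i, Module.length (MatCoordRing K (2 + r)) (kalmanTorModule K (2 + r) 2 1 i) =
        t i) ∧
      (∀ i, ∀ f ∈ irrelevantIdeal K (2 + r), ∀ w : kalmanTorModule K (2 + r) 2 1 i, f • w = 0) ∧
      ∀ i, t i + 2 * r.choose (i + 1) = (2 * r).choose (i + 1) + Nat.choose 0 i := by
  let e : (Fin 2 ⊕ Fin r) × Fin 2 ↪ Fin (2 + r) × Fin (2 + r) :=
    ⟨fun p => (finSumFinEquiv p.1, Fin.castAdd r p.2), fun p q h => by
      simpa [Prod.ext_iff] using h⟩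
  let Q := CategoryTheory.projectiveResolution
    (ModuleCat.of (MatCoordRing K (2 + r)) (MatCoordRing K (2 + r) ⧸ irrelevantIdeal K (2 + r)))
  have hk : Kills Q.complex (irrelevantIdeal K (2 + r)) := by
    intro X _ _ a ha i
    refine tMap_smul_eq_zero Q a (fun x => ?_) i
    obtain ⟨f, rfl⟩ := Ideal.Quotient.mk_surjective x
    exact Ideal.Quotient.eq_zero_iff_mem.2 (Ideal.mul_mem_right f _ ha)
  have h0 : tLen Q.complex 0 (MatCoordRing K (2 + r)) = 1 := by
    obtain ⟨E⟩ := nonempty_tHom_self_equiv Q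
    refine E.length_eq.trans (Module.length_eq_one_iff.2 ?_)
    exact isSimpleModule_iff_isCoatom.2 (irrelevantIdeal_isMaximal (2 + r)).out
  have hs : ∀ i, tLen Q.complex (i + 1) (MatCoordRing K (2 + r)) = 0 := fun i =>
    Module.length_eq_zero_iff.2 (subsingleton_tHom_self Q i)
  obtain ⟨t, ht, htr⟩ := exists_tLen_vanIdeal hk h0 hs e Finset.univ
  rw [← kalmanIdeal_eq_vanIdeal r e fun _ _ => rfl] at ht
  rw [Finset.card_univ, Fintype.card_fin] at htr
  refine ⟨t, fun i => ?_, fun i f hf w => ?_, htr⟩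
  · obtain ⟨E⟩ := nonempty_tor_equiv (X := KalmanCoordRing K (2 + r) 2 1) Q i
    exact E.length_eq.trans (ht i)
  · refine smul_tor_eq_zero f (fun x => ?_) i w
    obtain ⟨g, rfl⟩ := Ideal.Quotient.mk_surjective x
    exact Ideal.Quotient.eq_zero_iff_mem.2 (Ideal.mul_mem_right g _ hf)

end BettiNumbers

theorem stmt7 (K : Type u) [Field K] [IsAlgClosed K] (n : ℕ) (hn : 3 ≤ n) :
    kalmanBetti K n 2 1 0 = 1 ∧
    (∀ i : ℕ, 1 ≤ i → i ≤ n - 3 →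
      kalmanBetti K n 2 1 i = (2 * n - 4).choose (i + 1) - 2 * (n - 2).choose (i + 1)) ∧
    (∀ i : ℕ, n - 2 ≤ i → i ≤ 2 * n - 5 →
      kalmanBetti K n 2 1 i = (2 * n - 4).choose (i + 1)) ∧
    (∀ i : ℕ, 2 * n - 5 < i → Subsingleton ↥(kalmanTorModule K n 2 1 i)) := by
  obtain ⟨r, rfl⟩ : ∃ r, n = 2 + r := ⟨n - 2, by omega⟩
  obtain ⟨t, ht, hkill, htr⟩ := exists_length_kalmanTorModule (K := K) r
  have hb : ∀ i, kalmanBetti K (2 + r) 2 1 i = t i := by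
    intro i
    refine (finrank_eq_length_toNat _ (hkill i)).trans ?_
    rw [ht, ENat.toNat_natCast]
  have h2 : 2 * (2 + r) - 4 = 2 * r := by omega
  rw [h2, Nat.add_sub_cancel_left]
  refine ⟨?_, fun i hi hi' => ?_, fun i hi hi' => ?_, fun i hi => ?_⟩
  · rw [hb]
    have := htr 0
    simp only [zero_add, Nat.choose_one_right, Nat.choose_self] at this
    omega
  · rw [hb]
    have := htr i
    rw [Nat.choose_eq_zero_of_lt (show 0 < i by omega)] at this
    omega
  · rw [hb]
    have := htr i
    rw [Nat.choose_eq_zero_of_lt (show 0 < i by omega),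
      Nat.choose_eq_zero_of_lt (show r < i + 1 by omega)] at this
    omega
  · rw [← Module.length_eq_zero_iff (R := MatCoordRing K (2 + r)), ht]
    have := htr i
    rw [Nat.choose_eq_zero_of_lt (show 0 < i by omega),
      Nat.choose_eq_zero_of_lt (show 2 * r < i + 1 by omega)] at this
    have h : t i = 0 := by omega
    rw [h, Nat.cast_zero]
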